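/- arXiv:2410.05580 — 2 statements merged into one kernel-verified Lean document; each statement's English description precedes it below -/
import Mathlib

section
/- For every integer n ≥ 1 there exists a set of n points in the plane for which the maximum-length Hamiltonian (spanning) path is unique (up to reversal) and noncrossing, i.e., no two of its edges (straight-line segments) intersect in their relative interiors. -/
open scoped Classical

/-- A point in the Euclidean plane. -/
abbrev Pt := EuclideanSpace ℝ (Fin 2)

/-- Euclidean length of a polygonal path through a list of planar points. -/
noncomputable def epathLen (l : List Pt) : ℝ :=
  ((l.zip l.tail).map fun p => dist p.1 p.2).sum

/-- A Hamiltonian (spanning) path on a finite planar point set `S`. -/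
def IsHamPathOn (S : Finset Pt) (l : List Pt) : Prop :=
  l.Nodup ∧ l.toFinset = S

/-- A path is noncrossing if no two of its edges intersect in their relative
interiors (open segments). -/
def PathNoncrossing (l : List Pt) : Prop :=
  ∀ e₁ ∈ l.zip l.tail, ∀ e₂ ∈ l.zip l.tail, e₁ ≠ e₂ →
    openSegment ℝ e₁.1 e₁.2 ∩ openSegment ℝ e₂.1 e₂.2 = ∅

/-- Two natural numbers are adjacent if they differ by exactly one. -/
def NatAdj (i j : ℕ) : Prop := j = i + 1 ∨ i = j + 1

/-- Sum of the weights `w` of consecutive entries of a list of indices. -/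
noncomputable def pathWeight (w : ℕ → ℕ → ℝ) (l : List ℕ) : ℝ :=
  ((l.zip l.tail).map fun p => w p.1 p.2).sum

lemma pathWeight_cons_cons (w : ℕ → ℕ → ℝ) (a b : ℕ) (l : List ℕ) :
    pathWeight w (a :: b :: l) = w a b + pathWeight w (b :: l) := by
  simp [pathWeight]

lemma pathWeight_singleton (w : ℕ → ℕ → ℝ) (a : ℕ) : pathWeight w [a] = 0 := by
  simp [pathWeight]

lemma epathLen_map (x : ℕ → Pt) (l : List ℕ) :
    epathLen (l.map x) = pathWeight (fun i j => dist (x i) (x j)) l := by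
  simp only [epathLen, pathWeight, ← List.map_tail, List.zip_map, List.map_map]
  rfl

lemma pathWeight_range' (w : ℕ → ℕ → ℝ) (m s : ℕ) :
    pathWeight w (List.range' s (m + 1)) = ∑ k ∈ Finset.range m, w (s + k) (s + k + 1) := by
  induction m generalizing s with
  | zero => simp [pathWeight]
  | succ m ih =>
    have h : List.range' s (m + 1 + 1) = s :: (s + 1) :: List.range' (s + 1 + 1) m := by
      simp [List.range'_succ]
    rw [h, pathWeight_cons_cons, ← List.range'_succ, ih, Finset.sum_range_succ']
    rw [add_comm]
    congr 1
    refine Finset.sum_congr rfl fun k _ => ?_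
    rw [add_assoc s 1 k, add_comm 1 k]

/-- The indices `k` such that both `k` and `k + 1` occur in `l`. -/
noncomputable def stepSet (l : List ℕ) : Finset ℕ := l.toFinset.filter fun k => k + 1 ∈ l

lemma mem_stepSet {l : List ℕ} {k : ℕ} : k ∈ stepSet l ↔ k ∈ l ∧ k + 1 ∈ l := by
  simp [stepSet]

lemma stepSet_mono {l l' : List ℕ} (h : l ⊆ l') : stepSet l ⊆ stepSet l' := fun k hk => by
  rw [mem_stepSet] at *
  exact ⟨h hk.1, h hk.2⟩

lemma pathWeight_le (n : ℕ) (d : ℕ → ℕ → ℝ) (a : ℕ → ℝ) (hd : ∀ i j, d i j = d j i)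
    (h1 : ∀ i, i + 1 < n → a i + a (i + 1) ≤ d i (i + 1))
    (h2 : ∀ i j, i < n → j < n → i ≠ j → ¬ NatAdj i j → d i j < a i + a j)
    (l : List ℕ) (hl : l ≠ []) (hnd : l.Nodup) (hn : ∀ v ∈ l, v < n) :
    pathWeight d l + a (l.head hl) + a (l.getLast hl) ≤
      2 * (l.map a).sum + ∑ k ∈ stepSet l, (d k (k + 1) - a k - a (k + 1)) ∧
    (2 * (l.map a).sum + ∑ k ∈ stepSet l, (d k (k + 1) - a k - a (k + 1)) ≤
      pathWeight d l + a (l.head hl) + a (l.getLast hl) → l.IsChain NatAdj) := by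
  induction l with
  | nil => exact absurd rfl hl
  | cons u l ih =>
    cases l with
    | nil =>
      have : stepSet [u] = ∅ := by
        ext k; rw [mem_stepSet]; simp; omega
      simp [pathWeight_singleton, this]; linarith
    | cons v l =>
      have hnd' := (List.nodup_cons.1 hnd).2
      have hu : u ∉ v :: l := (List.nodup_cons.1 hnd).1
      have hun : u < n := hn u (by simp)
      have hvn : v < n := hn v (by simp)
      have huv : u ≠ v := by rintro rfl; simp at hu
      obtain ⟨ih1, ih2⟩ := ih (by simp) hnd' (fun w hw => hn w (List.mem_cons_of_mem _ hw))
      have hb : ∀ k ∈ stepSet (u :: v :: l), 0 ≤ d k (k + 1) - a k - a (k + 1) := by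
        intro k hk
        have := h1 k (hn _ (mem_stepSet.1 hk).2)
        linarith
      have hsub : stepSet (v :: l) ⊆ stepSet (u :: v :: l) :=
        stepSet_mono (List.subset_cons_self _ _)
      have hmono := Finset.sum_le_sum_of_subset_of_nonneg hsub fun k hk _ => hb k hk
      simp only [List.head_cons, List.getLast_cons_cons, List.map_cons, List.sum_cons,
        pathWeight_cons_cons, List.isChain_cons_cons] at ih1 ih2 ⊢
      by_cases hadj : NatAdj u v
      · have key : d u v - a u - a v +
            ∑ k ∈ stepSet (v :: l), (d k (k + 1) - a k - a (k + 1)) ≤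
            ∑ k ∈ stepSet (u :: v :: l), (d k (k + 1) - a k - a (k + 1)) := by
          have aux : ∀ m, m ∉ stepSet (v :: l) → m ∈ stepSet (u :: v :: l) →
              d u v - a u - a v = d m (m + 1) - a m - a (m + 1) →
              d u v - a u - a v + ∑ k ∈ stepSet (v :: l), (d k (k + 1) - a k - a (k + 1)) ≤
              ∑ k ∈ stepSet (u :: v :: l), (d k (k + 1) - a k - a (k + 1)) := by
            intro m hm hm' he
            rw [he, ← Finset.sum_insert (f := fun k => d k (k + 1) - a k - a (k + 1)) hm]
            exact Finset.sum_le_sum_of_subset_of_nonneg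
              (Finset.insert_subset hm' hsub) fun k hk _ => hb k hk
          rcases hadj with h | h
          · refine aux u (fun h' => hu (mem_stepSet.1 h').1) (mem_stepSet.2 (by simp [h])) (by rw [h])
          · refine aux v (fun h' => hu (h ▸ (mem_stepSet.1 h').2)) (mem_stepSet.2 (by simp [h])) ?_
            rw [hd u v, h]; ring
        exact ⟨by linarith, fun h => ⟨hadj, ih2 (by linarith)⟩⟩
      · have := h2 u v hun hvn huv hadj
        refine ⟨by linarith, fun h => ?_⟩
        exfalso; linarith

lemma isChain_lt_or_gt : ∀ l : List ℕ, l.Nodup → l.IsChain NatAdj →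
    l.IsChain (· < ·) ∨ l.IsChain (· > ·)
  | [], _, _ => by simp
  | [_], _, _ => by simp
  | [a, b], _, h => by
    simp [NatAdj] at h ⊢; omega
  | a :: b :: c :: l, hnd, h => by
    have ih := isChain_lt_or_gt (b :: c :: l) (List.nodup_cons.1 hnd).2
      (List.isChain_cons_cons.1 h).2
    have hac : a ≠ c := by rintro rfl; simp at hnd
    simp only [List.isChain_cons_cons, NatAdj] at h ih ⊢
    obtain ⟨hab, hbc, -⟩ := h
    rcases ih with ⟨h1, h2⟩ | ⟨h1, h2⟩
    · exact Or.inl ⟨by omega, h1, h2⟩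
    · exact Or.inr ⟨by omega, h1, h2⟩

lemma eq_range_or_reverse {n : ℕ} {l : List ℕ} (hp : l.Perm (List.range n))
    (h : l.IsChain NatAdj) : l = List.range n ∨ l = (List.range n).reverse := by
  rcases isChain_lt_or_gt l (hp.nodup_iff.2 List.nodup_range) h with h | h
  · left
    exact hp.eq_of_pairwise (fun a b _ _ h1 h2 => absurd h1 h2.asymm)
      (List.isChain_iff_pairwise.1 h) List.pairwise_lt_range
  · right
    exact (hp.trans (List.reverse_perm _).symm).eq_of_pairwise
      (fun a b _ _ h1 h2 => absurd h1 h2.asymm)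
      (List.isChain_iff_pairwise.1 h) (List.pairwise_reverse.2 List.pairwise_lt_range)

/-- If balls of radii `a i` around the points `x i` are disjoint exactly for consecutive indices,
and the two extreme indices have the smallest radii, then `x 0, …, x (n - 1)` is the unique
longest Hamiltonian path. -/
lemma longest_of_radii (n : ℕ) (hn : 1 ≤ n) (x : ℕ → Pt) (a : ℕ → ℝ)
    (hinj : Set.InjOn x {i | i < n})
    (h1 : ∀ i, i + 1 < n → a i + a (i + 1) ≤ dist (x i) (x (i + 1)))
    (h2 : ∀ i j, i < n → j < n → i ≠ j → ¬ NatAdj i j → dist (x i) (x j) < a i + a j)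
    (h3 : ∀ i j, i < n → j < n → i ≠ j → a 0 + a (n - 1) ≤ a i + a j)
    (L : List Pt) (hL : IsHamPathOn ((List.range n).map x).toFinset L) :
    epathLen L ≤ epathLen ((List.range n).map x) ∧
      (epathLen ((List.range n).map x) ≤ epathLen L →
        L = (List.range n).map x ∨ L = ((List.range n).map x).reverse) := by
  have hH : ((List.range n).map x).Nodup := by
    refine List.Nodup.map_on ?_ List.nodup_range
    intro i hi j hj
    exact hinj (by simpa using hi) (by simpa using hj)
  obtain ⟨l, hl, rfl⟩ : ∃ l : List ℕ, l.Perm (List.range n) ∧ L = l.map x := by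
    have hp := List.perm_of_nodup_nodup_toFinset_eq hL.1 hH hL.2
    have hinv : ∀ i < n, Function.invFunOn x {i | i < n} (x i) = i := fun i hi =>
      hinj.leftInvOn_invFunOn hi
    refine ⟨L.map (Function.invFunOn x {i | i < n}), ?_, ?_⟩
    · refine (hp.map _).trans (List.Perm.of_eq ?_)
      rw [List.map_map]
      conv_rhs => rw [← List.map_id (List.range n)]
      exact List.map_congr_left fun i hi => hinv i (by simpa using hi)
    · rw [List.map_map]
      conv_lhs => rw [← List.map_id L]
      refine List.map_congr_left fun p hp' => ?_
      obtain ⟨i, hi, rfl⟩ := List.mem_map.1 (hp.mem_iff.1 hp')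
      simp [hinv i (by simpa using hi)]
  obtain ⟨m, rfl⟩ : ∃ m, n = m + 1 := ⟨n - 1, by omega⟩
  have hmem : ∀ v, v ∈ l ↔ v < m + 1 := fun v => by rw [hl.mem_iff, List.mem_range]
  have hne : l ≠ [] := by rintro rfl; simpa using hmem 0
  have hnd : l.Nodup := hl.nodup_iff.2 List.nodup_range
  obtain ⟨k1, k2⟩ := pathWeight_le (m + 1) (fun i j => dist (x i) (x j)) a
    (fun i j => dist_comm _ _) h1 h2 l hne hnd (fun v hv => (hmem v).1 hv)
  have hstep : stepSet l = Finset.range m := by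
    ext k; rw [mem_stepSet, hmem, hmem, Finset.mem_range]; omega
  have hends : a 0 + a m ≤ a (l.head hne) + a (l.getLast hne) := by
    by_cases hm : m = 0
    · subst hm
      have e1 := (hmem _).1 (List.head_mem hne)
      have e2 := (hmem _).1 (List.getLast_mem hne)
      rw [Nat.lt_one_iff.1 e1, Nat.lt_one_iff.1 e2]
    · refine h3 _ _ ((hmem _).1 (List.head_mem hne)) ((hmem _).1 (List.getLast_mem hne)) ?_
      intro he
      have hlen : l.length = m + 1 := by simpa using hl.length_eq
      rw [List.head_eq_getElem, List.getLast_eq_getElem, hnd.getElem_inj_iff] at he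
      omega
  have hsum : (l.map a).sum = ∑ k ∈ Finset.range (m + 1), a k := by
    rw [(hl.map a).sum_eq]; rfl
  have hrange : pathWeight (fun i j => dist (x i) (x j)) (List.range (m + 1)) + a 0 + a m =
      2 * (l.map a).sum + ∑ k ∈ stepSet l, (dist (x k) (x (k + 1)) - a k - a (k + 1)) := by
    have e1 := Finset.sum_range_succ a m
    have e2 := Finset.sum_range_succ' a m
    rw [List.range_eq_range', pathWeight_range', hstep, hsum, Finset.sum_sub_distrib,
      Finset.sum_sub_distrib]
    simp only [zero_add]
    linarith
  rw [epathLen_map, epathLen_map]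
  refine ⟨by linarith, fun h => ?_⟩
  rw [← List.map_reverse]
  rcases eq_range_or_reverse hl (k2 (by linarith)) with rfl | rfl <;> simp

/-- The point of the unit circle with rational parameter `u`. -/
noncomputable def circlePt (u : ℝ) : Pt := !₂[2 * u / (1 + u ^ 2), (1 - u ^ 2) / (1 + u ^ 2)]

/-- The point at depth `Y` below the origin in the direction of slope `8 * t`. -/
noncomputable def lowPt (Y t : ℝ) : Pt := !₂[-(8 * Y * t), -Y]

lemma dist_sq_eq (p q : Pt) : dist p q ^ 2 = (p 0 - q 0) ^ 2 + (p 1 - q 1) ^ 2 := by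
  rw [EuclideanSpace.dist_eq, Real.sq_sqrt (by positivity)]
  simp [Fin.sum_univ_two, Real.dist_eq, sq_abs]

lemma dist_circlePt_lowPt_sq (u Y t : ℝ) :
    dist (circlePt u) (lowPt Y t) ^ 2 =
      1 + Y ^ 2 * (1 + 64 * t ^ 2) + 2 * Y * ((1 + 16 * t * u - u ^ 2) / (1 + u ^ 2)) := by
  rw [dist_sq_eq]
  have : (1 + u ^ 2) ≠ 0 := by positivity
  simp [circlePt, lowPt]
  field_simp
  ring

lemma dist_circlePt_sq (u v : ℝ) :
    dist (circlePt u) (circlePt v) ^ 2 = 4 * (u - v) ^ 2 / ((1 + u ^ 2) * (1 + v ^ 2)) := by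
  rw [dist_sq_eq]
  have : (1 + u ^ 2) ≠ 0 := by positivity
  have : (1 + v ^ 2) ≠ 0 := by positivity
  simp [circlePt]
  field_simp
  ring

lemma dist_circlePt_lt_one {u v : ℝ} (hu : 0 < u) (hu' : u ≤ 1 / 10) (hv : 0 < v)
    (hv' : v ≤ 1 / 10) : dist (circlePt u) (circlePt v) < 1 := by
  have h : dist (circlePt u) (circlePt v) ^ 2 < 1 := by
    rw [dist_circlePt_sq, div_lt_one (by positivity)]
    nlinarith [mul_pos hu hv, sq_nonneg (u * v)]
  nlinarith [dist_nonneg (x := circlePt u) (y := circlePt v)]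

lemma dist_lowPt_lt_one {Y Z t u : ℝ} (hY : 0 < Y) (hY' : Y ≤ 1 / 10) (hZ : 0 < Z)
    (hZ' : Z ≤ 1 / 10) (ht : 0 < t) (ht' : t ≤ 1 / 10) (hu : 0 < u) (hu' : u ≤ 1 / 10) :
    dist (lowPt Y t) (lowPt Z u) < 1 := by
  have h : dist (lowPt Y t) (lowPt Z u) ^ 2 < 1 := by
    rw [dist_sq_eq]
    simp only [lowPt]
    have h1 : 0 < Y * t := mul_pos hY ht
    have h2 : 0 < Z * u := mul_pos hZ hu
    have h3 : Y * t ≤ 1 / 100 := by nlinarith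
    have h4 : Z * u ≤ 1 / 100 := by nlinarith
    have h5 : (Y * t - Z * u) ^ 2 ≤ (1 / 100) ^ 2 := sq_le_sq' (by linarith) (by linarith)
    have h6 : (Y - Z) ^ 2 ≤ (1 / 10) ^ 2 := sq_le_sq' (by linarith) (by linarith)
    simp
    nlinarith
  nlinarith [dist_nonneg (x := lowPt Y t) (y := lowPt Z u)]

lemma one_lt_dist_circlePt_lowPt {u Y t : ℝ} (hY : 0 < Y) (ht : 0 < t) (hu : 0 < u)
    (hu' : u ≤ 1 / 10) : 1 < dist (circlePt u) (lowPt Y t) := by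
  have h : 1 < dist (circlePt u) (lowPt Y t) ^ 2 := by
    rw [dist_circlePt_lowPt_sq]
    have h1 : 0 < 1 + 16 * t * u - u ^ 2 := by nlinarith [mul_pos ht hu]
    have h2 : 0 < Y ^ 2 * (1 + 64 * t ^ 2) := by positivity
    have h3 : 0 < 2 * Y * ((1 + 16 * t * u - u ^ 2) / (1 + u ^ 2)) := by positivity
    linarith
  nlinarith [dist_nonneg (x := circlePt u) (y := lowPt Y t)]

lemma dist_circlePt_lowPt_lt {u v Y t : ℝ} (hY : 0 < Y)
    (h : 0 < (u - v) * (8 * t * (1 - u * v) - (u + v))) :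
    dist (circlePt v) (lowPt Y t) < dist (circlePt u) (lowPt Y t) := by
  refine lt_of_pow_lt_pow_left₀ 2 dist_nonneg ?_
  rw [dist_circlePt_lowPt_sq, dist_circlePt_lowPt_sq]
  have : (1 + 16 * t * v - v ^ 2) / (1 + v ^ 2) < (1 + 16 * t * u - u ^ 2) / (1 + u ^ 2) := by
    rw [div_lt_div_iff₀ (by positivity) (by positivity)]
    linarith
  nlinarith

lemma dist_circlePt_lowPt_mono {Y Z t u : ℝ} (hY : 0 < Y) (hYZ : 100 * Y ≤ Z) (ht : 0 < t)
    (ht' : t ≤ 1 / 10) :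
    dist (circlePt t) (lowPt Y t) ≤ dist (circlePt u) (lowPt Z u) := by
  refine (pow_le_pow_iff_left₀ dist_nonneg dist_nonneg two_ne_zero).1 ?_
  rw [dist_circlePt_lowPt_sq, dist_circlePt_lowPt_sq]
  have h1 : (1 + 16 * t * t - t ^ 2) / (1 + t ^ 2) ≤ 2 := by
    rw [div_le_iff₀ (by positivity)]; nlinarith
  have h2 : 1 ≤ (1 + 16 * u * u - u ^ 2) / (1 + u ^ 2) := by
    rw [le_div_iff₀ (by positivity)]; nlinarith
  have h3 : Y * ((1 + 16 * t * t - t ^ 2) / (1 + t ^ 2)) ≤ Y * 2 := by gcongr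
  have h4 : Z * 1 ≤ Z * ((1 + 16 * u * u - u ^ 2) / (1 + u ^ 2)) :=
    mul_le_mul_of_nonneg_left h2 (by linarith)
  have h5 : Y ^ 2 * (1 + 64 * t ^ 2) ≤ Y ^ 2 * 2 := by gcongr; nlinarith
  have h6 : Z ^ 2 * 1 ≤ Z ^ 2 * (1 + 64 * u ^ 2) := by gcongr; nlinarith
  have h7 : (100 * Y) ^ 2 ≤ Z ^ 2 := by gcongr
  nlinarith

/-- An affine functional vanishing on `lowPt Y t` and `circlePt (3 * t)`. -/
noncomputable def sideFun (Y t : ℝ) (z : Pt) : ℝ :=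
  z 0 * (1 - 9 * t ^ 2 + Y * (1 + 9 * t ^ 2)) - z 1 * (6 * t + 8 * Y * t * (1 + 9 * t ^ 2)) +
    2 * Y * t * (1 - 36 * t ^ 2)

lemma sideFun_combo (Y t : ℝ) {c d : ℝ} (h : c + d = 1) (y z : Pt) :
    sideFun Y t (c • y + d • z) = c * sideFun Y t y + d * sideFun Y t z := by
  obtain rfl : d = 1 - c := by linarith
  simp [sideFun]
  ring

lemma sideFun_circlePt (Y t u : ℝ) : sideFun Y t (circlePt u) =
    (u - 3 * t) * ((6 * t + 10 * Y * t) * u + (2 + 2 * Y + 48 * Y * t ^ 2)) / (1 + u ^ 2) := by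
  have : (1 + u ^ 2) ≠ 0 := by positivity
  simp [sideFun, circlePt]
  field_simp
  ring

lemma sideFun_lowPt_self (Y t : ℝ) : sideFun Y t (lowPt Y t) = 0 := by
  simp [sideFun, lowPt]
  ring

lemma sideFun_lowPt_pos {Y t Z u : ℝ} (hY : 0 < Y) (hY' : Y ≤ 1 / 10) (ht : 0 < t)
    (ht' : t ≤ 1 / 30) (hZ : 0 < Z) (h : Z * u ≤ Y * t / 10) :
    0 < sideFun Y t (lowPt Z u) := by
  have h1 : t ^ 2 ≤ 1 / 900 := by nlinarith
  have h2 : 0 < Y * t := mul_pos hY ht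
  have h3 : 0 < 1 - 9 * t ^ 2 + Y * (1 + 9 * t ^ 2) := by
    have : 0 < Y * (1 + 9 * t ^ 2) := by positivity
    nlinarith
  have h4 : 1 - 9 * t ^ 2 + Y * (1 + 9 * t ^ 2) ≤ 2 := by nlinarith [sq_nonneg t]
  have h5 : Z * u * (1 - 9 * t ^ 2 + Y * (1 + 9 * t ^ 2)) ≤ Y * t / 10 * 2 :=
    (mul_le_mul_of_nonneg_right h h3.le).trans (mul_le_mul_of_nonneg_left h4 (by linarith))
  have h6 : 0 < Z * (6 * t + 8 * Y * t * (1 + 9 * t ^ 2)) := by positivity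
  have h7 : Y * t * (36 * t ^ 2) ≤ Y * t * (36 / 900) := by gcongr; linarith
  have e : sideFun Y t (lowPt Z u) = Z * (6 * t + 8 * Y * t * (1 + 9 * t ^ 2)) +
      2 * (Y * t) - 2 * (Y * t * (36 * t ^ 2)) -
      8 * (Z * u * (1 - 9 * t ^ 2 + Y * (1 + 9 * t ^ 2))) := by
    simp [sideFun, lowPt]
    ring
  rw [e]
  linarith

lemma pathNoncrossing_of_sideFun (n : ℕ) (x : ℕ → Pt) (f : ℕ → Pt → ℝ)
    (hf : ∀ i (c d : ℝ), c + d = 1 → ∀ y z, f i (c • y + d • z) = c * f i y + d * f i z)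
    (h0 : ∀ i, 2 * i + 2 < n → f i (x (2 * i)) < 0)
    (h1 : ∀ i, 2 * i + 2 < n → f i (x (2 * i + 1)) = 0)
    (h2 : ∀ i, 2 * i + 2 < n → f i (x (2 * i + 2)) = 0)
    (h3 : ∀ i m, m < n → 2 * i + 2 < m → 0 < f i (x m)) :
    PathNoncrossing ((List.range n).map x) := by
  have key : ∀ a b, a < b → b + 1 < n →
      openSegment ℝ (x a) (x (a + 1)) ∩ openSegment ℝ (x b) (x (b + 1)) = ∅ := by
    intro a b hab hb
    rw [Set.eq_empty_iff_forall_notMem]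
    rintro z ⟨⟨c, d, hc, hd, hcd, rfl⟩, ⟨c', d', hc', hd', hcd', he⟩⟩
    rcases Nat.even_or_odd' a with ⟨i, rfl | rfl⟩
    · have he' := congrArg (f i) he
      rw [hf i _ _ hcd, hf i _ _ hcd', h1 i (by omega)] at he'
      have hnn : ∀ m, m < n → 2 * i + 1 ≤ m → 0 ≤ f i (x m) := by
        intro m hm him
        rcases (by omega : m = 2 * i + 1 ∨ m = 2 * i + 2 ∨ 2 * i + 2 < m) with rfl | rfl | h
        · exact (h1 i (by omega)).ge
        · exact (h2 i (by omega)).ge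
        · exact (h3 i m hm h).le
      have k1 := mul_nonneg hc'.le (hnn b (by omega) (by omega))
      have k2 := mul_nonneg hd'.le (hnn (b + 1) (by omega) (by omega))
      have k3 := mul_neg_of_pos_of_neg hc (h0 i (by omega))
      linarith
    · have he' := congrArg (f i) he
      rw [hf i _ _ hcd, hf i _ _ hcd', h1 i (by omega), h2 i (by omega)] at he'
      have k1 : 0 ≤ c' * f i (x b) := by
        refine mul_nonneg hc'.le ?_
        rcases (by omega : b = 2 * i + 2 ∨ 2 * i + 2 < b) with rfl | h
        · exact (h2 i (by omega)).ge
        · exact (h3 i b (by omega) h).le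
      have k2 := mul_pos hd' (h3 i (b + 1) (by omega) (by omega))
      linarith
  have hedge : ∀ e ∈ ((List.range n).map x).zip ((List.range n).map x).tail,
      ∃ k, k + 1 < n ∧ e = (x k, x (k + 1)) := by
    intro e he
    obtain ⟨k, hk, rfl⟩ := List.mem_iff_getElem.1 he
    simp at hk
    exact ⟨k, by omega, by simp⟩
  intro e₁ he₁ e₂ he₂ hne
  obtain ⟨a, ha, rfl⟩ := hedge e₁ he₁
  obtain ⟨b, hb, rfl⟩ := hedge e₂ he₂
  rcases lt_trichotomy a b with h | rfl | h
  · exact key a b h hb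
  · exact absurd rfl hne
  · rw [Set.inter_comm]; exact key b a h ha

lemma longest_of_parameters (n : ℕ) (hn : 1 ≤ n) (t Y : ℕ → ℝ) (x : ℕ → Pt)
    (ht : ∀ i, 0 < t i) (ht' : ∀ i ≤ n, t i ≤ 1 / 10) (htm : ∀ i j, i < j → 3 * t i ≤ t j)
    (hts : ∀ i, t (i + 1) = 3 * t i)
    (hY : ∀ i, 0 < Y i) (hY' : ∀ i, Y i ≤ 1 / 10) (hYm : ∀ i j, i < j → 100 * Y j ≤ Y i)
    (hYt : ∀ i j, i < j → Y j * t j ≤ Y i * t i / 10)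
    (hx : ∀ i, x (2 * i) = circlePt (t i)) (hx' : ∀ i, x (2 * i + 1) = lowPt (Y i) (t i)) :
    Set.InjOn x {i | i < n} ∧ PathNoncrossing ((List.range n).map x) ∧
    ∀ L : List Pt, IsHamPathOn ((List.range n).map x).toFinset L →
      epathLen L ≤ epathLen ((List.range n).map x) ∧
      (epathLen ((List.range n).map x) ≤ epathLen L →
        L = (List.range n).map x ∨ L = ((List.range n).map x).reverse) := by
  have htm2 : ∀ i j, i + 1 < j → 9 * t i ≤ t j := fun i j hij => by
    have := htm (i + 1) j hij
    rw [hts] at this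
    linarith
  have hinj : Set.InjOn x {i | i < n} := by
    have hcl : ∀ i j, 2 * i < n → circlePt (t i) ≠ lowPt (Y j) (t j) := fun i j hi h => by
      have := one_lt_dist_circlePt_lowPt (hY j) (ht j) (ht i) (ht' i (by omega))
      rw [h, dist_self] at this
      linarith
    have htne : ∀ i j, circlePt (t i) = circlePt (t j) → i = j := fun i j h => by
      have h2 := dist_circlePt_sq (t i) (t j)
      rw [h, dist_self] at h2
      have h3 : t i = t j := by
        have : (1 + t i ^ 2) ≠ 0 := by positivity
        have : (1 + t j ^ 2) ≠ 0 := by positivity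
        field_simp at h2
        nlinarith
      rcases lt_trichotomy i j with hij | hij | hij
      · linarith [htm i j hij, ht i]
      · exact hij
      · linarith [htm j i hij, ht j]
    have hYne : ∀ i j, lowPt (Y i) (t i) = lowPt (Y j) (t j) → i = j := fun i j h => by
      have h2 := congrArg (fun z : Pt => z 1) h
      simp [lowPt] at h2
      rcases lt_trichotomy i j with hij | hij | hij
      · linarith [hYm i j hij, hY i]
      · exact hij
      · linarith [hYm j i hij, hY j]
    intro a ha b hb hab
    simp only [Set.mem_ofPred_eq] at ha hb
    rcases Nat.even_or_odd' a with ⟨i, rfl | rfl⟩ <;> rcases Nat.even_or_odd' b with ⟨j, rfl | rfl⟩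
    · rw [hx, hx] at hab; rw [htne i j hab]
    · rw [hx, hx'] at hab; exact absurd hab (hcl i j ha)
    · rw [hx, hx'] at hab; exact absurd hab.symm (hcl j i hb)
    · rw [hx', hx'] at hab; rw [hYne i j hab]
  refine ⟨hinj, ?_, ?_⟩
  · refine pathNoncrossing_of_sideFun n x (fun i => sideFun (Y i) (t i))
      (fun i c d h y z => sideFun_combo _ _ h y z) ?_ ?_ ?_ ?_
    · intro i _
      have h1 := ht i
      have h2 := hY i
      simp only [hx, sideFun_circlePt]
      refine div_neg_of_neg_of_pos (mul_neg_of_neg_of_pos (by linarith) (by positivity))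
        (by positivity)
    · intro i _
      simp only [hx', sideFun_lowPt_self]
    · intro i _
      simp only [show 2 * i + 2 = 2 * (i + 1) by ring, hx, sideFun_circlePt, hts]
      simp
    · intro i m hm him
      have h1 := ht i
      have h2 := hY i
      rcases Nat.even_or_odd' m with ⟨j, rfl | rfl⟩
      · simp only [hx, sideFun_circlePt]
        have h3 := ht j
        have h4 := htm2 i j (by omega)
        refine div_pos (mul_pos (by linarith) (by positivity)) (by positivity)
      · simp only [hx']
        have h3 := ht' (i + 1) (by omega)
        rw [hts] at h3
        exact sideFun_lowPt_pos h2 (hY' i) h1 (by linarith) (hY j) (hYt i j (by omega))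
  · set K := (n - 2) / 2 with hK
    set D : ℕ → ℝ := fun i => dist (circlePt (t i)) (lowPt (Y i) (t i)) with hD
    have hDK : ∀ i, 2 * i + 1 < n → D K ≤ D i := by
      intro i hi
      rcases (by omega : i < K ∨ i = K) with h | rfl
      · exact dist_circlePt_lowPt_mono (hY K) (hYm i K h) (ht K) (ht' K (by omega))
      · exact le_rfl
    have hone : 1 < D K := one_lt_dist_circlePt_lowPt (hY K) (ht K) (ht K) (ht' K (by omega))
    have hsucc : ∀ i, 2 * i + 2 < n → D i ≤ dist (circlePt (t (i + 1))) (lowPt (Y i) (t i)) := by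
      intro i hi
      refine (dist_circlePt_lowPt_lt (hY i) ?_).le
      have h1 := ht i
      have h2 := ht' (i + 1) (by omega)
      rw [hts] at *
      have h3 : t i * t i ≤ 1 / 900 := by nlinarith
      refine mul_pos (by linarith) ?_
      nlinarith [mul_le_mul_of_nonneg_left h3 h1.le]
    have hfar : ∀ i j, 2 * i + 1 < n → 2 * j < n → j ≠ i → j ≠ i + 1 →
        dist (circlePt (t j)) (lowPt (Y i) (t i)) < D i := by
      intro i j hi hj hne hne'
      refine dist_circlePt_lowPt_lt (hY i) ?_
      have h1 := ht i
      have h2 := ht j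
      have h3 := ht' i (by omega)
      have h4 := ht' j (by omega)
      have h5 : 0 < t i * t j := mul_pos h1 h2
      have h6 : t i * t j ≤ 1 / 100 := by nlinarith
      have h7 := mul_le_mul_of_nonneg_left h6 h1.le
      have h8 := mul_pos h1 h5
      rcases lt_or_gt_of_ne hne with h | h
      · have := htm j i h
        exact mul_pos (by linarith) (by linarith)
      · have := htm2 i j (by omega)
        exact mul_pos_of_neg_of_neg (by linarith) (by linarith)
    have ha0 : ∀ i, (fun m => if Even m then D K / 2 else D (m / 2) - D K / 2) (2 * i) = D K / 2 :=
      fun i => by simp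
    have ha1 : ∀ i, (fun m => if Even m then D K / 2 else D (m / 2) - D K / 2) (2 * i + 1) =
        D i - D K / 2 := fun i => by
      have : (2 * i + 1) / 2 = i := by omega
      simp [this]
    generalize (fun m => if Even m then D K / 2 else D (m / 2) - D K / 2) = a at ha0 ha1
    have hage : ∀ m, m < n → D K / 2 ≤ a m := by
      intro m hm
      rcases Nat.even_or_odd' m with ⟨i, rfl | rfl⟩
      · rw [ha0]
      · rw [ha1]; linarith [hDK i hm]
    have hlast : a (n - 1) = D K / 2 := by
      rcases Nat.even_or_odd' (n - 1) with ⟨i, h | h⟩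
      · rw [h, ha0]
      · rw [h, ha1, show i = K by omega]; ring
    refine longest_of_radii n hn x a hinj ?_ ?_ ?_
    · intro m hm
      rcases Nat.even_or_odd' m with ⟨i, rfl | rfl⟩
      · rw [ha0, ha1, hx, hx']; simp [hD]
      · rw [ha1, hx', show 2 * i + 1 + 1 = 2 * (i + 1) by ring, ha0, hx, dist_comm]
        linarith [hsucc i (by omega)]
    · intro m m' hm hm' hne hadj
      simp only [NatAdj, not_or] at hadj
      rcases Nat.even_or_odd' m with ⟨i, rfl | rfl⟩ <;>
        rcases Nat.even_or_odd' m' with ⟨j, rfl | rfl⟩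
      · rw [ha0, ha0, hx, hx]
        linarith [dist_circlePt_lt_one (ht i) (ht' i (by omega)) (ht j) (ht' j (by omega))]
      · rw [ha0, ha1, hx, hx']
        linarith [hfar j i hm' hm (by omega) (by omega)]
      · rw [ha0, ha1, hx, hx', dist_comm]
        linarith [hfar i j hm hm' (by omega) (by omega)]
      · rw [ha1, ha1, hx', hx']
        linarith [dist_lowPt_lt_one (hY i) (hY' i) (hY j) (hY' j) (ht i) (ht' i (by omega))
          (ht j) (ht' j (by omega)), hDK i hm, hDK j hm']
    · intro i j hi hj _
      have h0 := ha0 0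
      rw [mul_zero] at h0
      rw [h0, hlast]
      exact add_le_add (hage i hi) (hage j hj)

/-- For every `n ≥ 1` there is a set of `n` points in the plane whose longest
Hamiltonian path is unique (up to reversal) and noncrossing. -/
theorem stmt7 (n : ℕ) (hn : 1 ≤ n) :
    ∃ S : Finset Pt, S.card = n ∧
      ∃ H : List Pt, IsHamPathOn S H ∧
        (∀ L : List Pt, IsHamPathOn S L → epathLen L ≤ epathLen H) ∧
        PathNoncrossing H ∧
        (∀ L : List Pt, IsHamPathOn S L →
          (∀ L' : List Pt, IsHamPathOn S L' → epathLen L' ≤ epathLen L) →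
          L = H ∨ L = H.reverse) := by
  have h3 : ∀ i j : ℕ, i < j → (3 : ℝ) * 3 ^ i ≤ 3 ^ j := fun i j h => by
    rw [← pow_succ']
    exact pow_le_pow_right₀ (by norm_num) h
  have h100 : ∀ i j : ℕ, i < j → (100 : ℝ) * (1 / 100) ^ j ≤ (1 / 100) ^ i := fun i j h => by
    have : (1 / 100 : ℝ) ^ j ≤ (1 / 100) ^ (i + 1) :=
      pow_le_pow_of_le_one (by norm_num) (by norm_num) h
    rw [pow_succ] at this
    linarith
  have hprod : ∀ i j : ℕ, i < j → (3 / 100 : ℝ) ^ j ≤ (3 / 100) ^ i / 10 := fun i j h => by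
    have h1 : (3 / 100 : ℝ) ^ j ≤ (3 / 100) ^ (i + 1) :=
      pow_le_pow_of_le_one (by norm_num) (by norm_num) h
    have h2 : (0 : ℝ) < (3 / 100) ^ i := by positivity
    rw [pow_succ] at h1
    linarith
  have hpos : (0 : ℝ) < 1 / (10 * 3 ^ n) := by positivity
  obtain ⟨hinj, hnc, hmax⟩ := longest_of_parameters n hn
    (fun i => 3 ^ i * (1 / (10 * 3 ^ n))) (fun i => (1 / 100) ^ i / 10)
    (fun m => if Even m then circlePt (3 ^ (m / 2) * (1 / (10 * 3 ^ n)))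
      else lowPt ((1 / 100) ^ (m / 2) / 10) (3 ^ (m / 2) * (1 / (10 * 3 ^ n))))
    (fun i => by positivity)
    (fun i hi => by
      have : (3 : ℝ) ^ i ≤ 3 ^ n := pow_le_pow_right₀ (by norm_num) hi
      rw [mul_one_div, div_le_div_iff₀ (by positivity) (by norm_num)]
      linarith)
    (fun i j h => by
      rw [← mul_assoc]
      exact mul_le_mul_of_nonneg_right (h3 i j h) hpos.le)
    (fun i => by rw [pow_succ]; ring)
    (fun i => by positivity)
    (fun i => by
      have : (1 / 100 : ℝ) ^ i ≤ 1 := pow_le_one₀ (by norm_num) (by norm_num)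
      linarith)
    (fun i j h => by linarith [h100 i j h])
    (fun i j h => by
      have e : ∀ k : ℕ, (1 / 100 : ℝ) ^ k / 10 * (3 ^ k * (1 / (10 * 3 ^ n))) =
          (3 / 100) ^ k * (1 / (10 * 3 ^ n) / 10) := fun k => by
        rw [show (3 / 100 : ℝ) = 1 / 100 * 3 by norm_num, mul_pow]
        ring
      rw [e, e]
      have := mul_le_mul_of_nonneg_right (hprod i j h)
        (by positivity : (0 : ℝ) ≤ 1 / (10 * 3 ^ n) / 10)
      linarith)
    (fun i => by simp)
    (fun i => by
      have : (2 * i + 1) / 2 = i := by omega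
      simp [this])
  generalize (fun m => if Even m then circlePt (3 ^ (m / 2) * (1 / (10 * 3 ^ n)))
      else lowPt ((1 / 100) ^ (m / 2) / 10) (3 ^ (m / 2) * (1 / (10 * 3 ^ n)))) = x at *
  have hnd : ((List.range n).map x).Nodup :=
    List.Nodup.map_on (fun i hi j hj => hinj (by simpa using hi) (by simpa using hj))
      List.nodup_range
  have hH : IsHamPathOn ((List.range n).map x).toFinset ((List.range n).map x) := ⟨hnd, rfl⟩
  refine ⟨((List.range n).map x).toFinset, ?_, (List.range n).map x, hH,
    fun L hL => (hmax L hL).1, hnc, fun L hL h => (hmax L hL).2 (h _ hH)⟩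
  rw [List.toFinset_card_of_nodup hnd]
  simp
end

section
/- For every integer n ≥ 3 there exists a set of n points in the plane for which the maximum-length Hamiltonian (spanning) cycle is unique (up to rotation and reflection) and noncrossing. -/
open scoped Classical

/-- Euclidean length of a Hamiltonian cycle through a list of planar points:
sum of distances over consecutive pairs including the wrap-around pair. -/
noncomputable def ecycleLen (l : List Pt) : ℝ :=
  ((l.zip (l.rotate 1)).map fun p => dist p.1 p.2).sum

/-- A Hamiltonian (spanning) cycle on a finite planar point set `S`, given as a
cyclic ordering. -/
def IsHamCycleOn (S : Finset Pt) (l : List Pt) : Prop :=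
  l.Nodup ∧ l.toFinset = S

/-- A cycle is noncrossing if no two of its edges intersect in their relative
interiors (open segments). -/
def CycleNoncrossing (l : List Pt) : Prop :=
  ∀ e₁ ∈ l.zip (l.rotate 1), ∀ e₂ ∈ l.zip (l.rotate 1), e₁ ≠ e₂ →
    openSegment ℝ e₁.1 e₁.2 ∩ openSegment ℝ e₂.1 e₂.2 = ∅

/-- The edge set of the closed polygon `f 0, f 1, …, f (n - 1)`. -/
noncomputable def cycleEdges {α : Type*} [DecidableEq α] (n : ℕ) (f : ℕ → α) : Finset (Sym2 α) :=
  (Finset.range n).image fun i => s(f i, f ((i + 1) % n))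

theorem succ_mod_cases {n i : ℕ} (hi : i < n) :
    (i + 1 < n ∧ (i + 1) % n = i + 1) ∨ (i + 1 = n ∧ (i + 1) % n = 0) := by
  rcases Nat.lt_or_ge (i + 1) n with h | h
  · exact Or.inl ⟨h, Nat.mod_eq_of_lt h⟩
  · have : i + 1 = n := by omega
    exact Or.inr ⟨this, by rw [this, Nat.mod_self]⟩

theorem zip_rotate_map_range {α : Type*} (n : ℕ) (f : ℕ → α) :
    ((List.range n).map f).zip (((List.range n).map f).rotate 1) =
      (List.range n).map fun i => (f i, f ((i + 1) % n)) := by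
  apply List.ext_getElem <;> simp [List.getElem_rotate]

theorem ecycleLen_map_range (n : ℕ) (f : ℕ → Pt) :
    ecycleLen ((List.range n).map f) = ∑ i ∈ Finset.range n, dist (f i) (f ((i + 1) % n)) := by
  rw [ecycleLen, zip_rotate_map_range, List.map_map, ← List.sum_toFinset _ List.nodup_range,
    List.toFinset_range]
  rfl

theorem sum_range_succ_mod (n : ℕ) (g : ℕ → ℝ) :
    ∑ i ∈ Finset.range n, g ((i + 1) % n) = ∑ i ∈ Finset.range n, g i := by
  cases n with
  | zero => simp
  | succ m =>
    rw [Finset.sum_range_succ, Finset.sum_range_succ' g, Nat.mod_self]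
    congr 1
    refine Finset.sum_congr rfl fun i hi => ?_
    rw [Nat.mod_eq_of_lt (by simpa using hi)]

theorem edge_injOn {α : Type*} {n : ℕ} (hn : 3 ≤ n) {f : ℕ → α}
    (hf : Set.InjOn f (Set.Iio n)) :
    Set.InjOn (fun i => s(f i, f ((i + 1) % n))) (Finset.range n : Set ℕ) := by
  intro i hi j hj h
  simp only [Finset.coe_range, Set.mem_Iio] at hi hj
  have hi' : (i + 1) % n < n := Nat.mod_lt _ (by omega)
  have hj' : (j + 1) % n < n := Nat.mod_lt _ (by omega)
  rcases Sym2.eq_iff.1 h with ⟨h1, -⟩ | ⟨h1, h2⟩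
  · exact hf hi hj h1
  · have e1 := hf hi hj' h1
    have e2 := hf hi' hj h2
    rcases succ_mod_cases hi with h | h <;> rcases succ_mod_cases hj with h' | h' <;> omega

/-- The length of a closed polygon, with vertex potentials `α` split off. -/
theorem ecycleLen_eq_sum_excess {n : ℕ} (hn : 3 ≤ n) {f : ℕ → Pt}
    (hf : Set.InjOn f (Set.Iio n)) (α : Pt → ℝ) (c : Sym2 Pt → ℝ)
    (hc : ∀ p q, c s(p, q) = dist p q - α p - α q) :
    ecycleLen ((List.range n).map f) =
      ∑ e ∈ cycleEdges n f, c e + 2 * ∑ p ∈ ((List.range n).map f).toFinset, α p := by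
  have h1 : ((List.range n).map f).toFinset = (Finset.range n).image f := by
    ext; simp
  rw [ecycleLen_map_range, cycleEdges, Finset.sum_image (edge_injOn hn hf), h1,
    Finset.sum_image (by simpa using hf)]
  simp only [hc, Finset.sum_sub_distrib]
  rw [sum_range_succ_mod n fun i => α (f i)]
  ring

theorem eq_of_cycleEdges_subset {α : Type*} [DecidableEq α] {n : ℕ} {f g : ℕ → α}
    (hf : Set.InjOn f (Set.Iio n)) (hg : Set.InjOn g (Set.Iio n))
    (hE : cycleEdges n f ⊆ cycleEdges n g) (h0 : f 0 = g 0) (h1 : f 1 = g 1) :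
    ∀ i < n, f i = g i := by
  intro i
  induction i using Nat.strong_induction_on with
  | _ i ih =>
    intro hi
    match i, ih, hi with
    | 0, _, _ => exact h0
    | 1, _, _ => exact h1
    | k + 2, ih, hi =>
      have e0 := ih k (by omega) (by omega)
      have e1 := ih (k + 1) (by omega) (by omega)
      have hmem : s(f (k + 1), f (k + 2)) ∈ cycleEdges n g := by
        apply hE
        refine Finset.mem_image.2 ⟨k + 1, by simp; omega, ?_⟩
        rw [Nat.mod_eq_of_lt (by omega)]
      obtain ⟨j, hj, hs⟩ := Finset.mem_image.1 hmem
      simp only [Finset.mem_range] at hj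
      have hj' : (j + 1) % n < n := Nat.mod_lt _ (by omega)
      rw [e1] at hs
      have hk1 : k + 1 ∈ Set.Iio n := by simp; omega
      rcases Sym2.eq_iff.1 hs with ⟨a, b⟩ | ⟨a, b⟩
      · have := hg hj hk1 a
        subst this
        rw [← b, Nat.mod_eq_of_lt (by omega)]
      · have := hg hj' hk1 b
        have hjk : j = k := by
          rcases succ_mod_cases hj with h | h <;> omega
        subst hjk
        have := hf (by simp; omega) (by simp; omega) (e0.trans a)
        omega

theorem cycleEdges_reflect {α : Type*} [DecidableEq α] {n : ℕ} (g : ℕ → α) :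
    cycleEdges n (fun i => g ((n - i) % n)) = cycleEdges n g := by
  have key : ∀ i < n, (n - (i + 1) % n) % n = n - 1 - i ∧ (n - i) % n = (n - 1 - i + 1) % n := by
    intro i hi
    have : n - 1 - i + 1 = n - i := by omega
    refine ⟨?_, by rw [this]⟩
    rcases succ_mod_cases hi with h | h
    · rw [h.2, Nat.mod_eq_of_lt (by omega)]; omega
    · rw [h.2, Nat.sub_zero, Nat.mod_self]; omega
  ext e
  simp only [cycleEdges, Finset.mem_image, Finset.mem_range]
  constructor
  · rintro ⟨i, hi, rfl⟩
    refine ⟨n - 1 - i, by omega, ?_⟩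
    rw [(key i hi).1, ← (key i hi).2, Sym2.eq_swap]
  · rintro ⟨i, hi, rfl⟩
    refine ⟨n - 1 - i, by omega, ?_⟩
    have h := key (n - 1 - i) (by omega)
    have hh : n - 1 - (n - 1 - i) = i := by omega
    rw [hh] at h
    rw [h.1, h.2, Sym2.eq_swap]

theorem map_range_getD {α : Type*} (L : List α) (d : α) :
    (List.range L.length).map (fun i => L.getD i d) = L := by
  apply List.ext_getElem
  · simp
  · intro i h1 h2
    simp [h2]

theorem rotate_one_reverse_map_range {α : Type*} {n : ℕ} (g : ℕ → α) :
    (((List.range n).map g).rotate 1).reverse = (List.range n).map fun i => g ((n - i) % n) := by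
  apply List.ext_getElem
  · simp
  · intro i h1 h2
    have hi : i < n := by simpa using h2
    have : n - 1 - i + 1 = n - i := by omega
    simp [List.getElem_rotate, this]

theorem reverse_rotate_one_injOn {α : Type*} {n : ℕ} {g : ℕ → α}
    (hg : Set.InjOn g (Set.Iio n)) : Set.InjOn (fun i => g ((n - i) % n)) (Set.Iio n) := by
  intro i hi j hj h
  simp only [Set.mem_Iio] at hi hj
  have := hg (Nat.mod_lt _ (by omega)) (Nat.mod_lt _ (by omega)) h
  rcases Nat.eq_zero_or_pos i with rfl | hi' <;> rcases Nat.eq_zero_or_pos j with rfl | hj'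
  · rfl
  · rw [Nat.sub_zero, Nat.mod_self, Nat.mod_eq_of_lt (by omega)] at this; omega
  · rw [Nat.sub_zero, Nat.mod_self, Nat.mod_eq_of_lt (by omega)] at this; omega
  · rw [Nat.mod_eq_of_lt (by omega), Nat.mod_eq_of_lt (by omega)] at this; omega

theorem injOn_of_nodup_map_range {α : Type*} {n : ℕ} {f : ℕ → α}
    (h : ((List.range n).map f).Nodup) : Set.InjOn f (Set.Iio n) := by
  intro i hi j hj hij
  exact List.inj_on_of_nodup_map h (by simpa using hi) (by simpa using hj) hij

/-- A cyclic list is determined up to rotation and reflection by its edges. -/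
theorem eq_rotate_or_reverse_of_edges {n : ℕ} (hn : 3 ≤ n) {g : ℕ → Pt}
    (hg : Set.InjOn g (Set.Iio n)) {L : List Pt} (hL : L.Nodup) (hlen : L.length = n)
    (hmem : g 0 ∈ L)
    (hE : ∀ r, cycleEdges n (fun i => (L.rotate r).getD i 0) ⊆ cycleEdges n g) :
    ∃ r : ℕ, L = ((List.range n).map g).rotate r ∨ L = (((List.range n).map g).rotate r).reverse := by
  obtain ⟨k, hk, hk0⟩ := List.getElem_of_mem hmem
  set L' := L.rotate k with hL'
  have hlen' : L'.length = n := by simp [hL', hlen]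
  set f : ℕ → Pt := fun i => L'.getD i 0 with hfdef
  have hLf : L' = (List.range n).map f := by rw [← hlen', map_range_getD]
  have hf : Set.InjOn f (Set.Iio n) :=
    injOn_of_nodup_map_range (hLf ▸ (List.nodup_rotate.2 hL))
  have hf0 : f 0 = g 0 := by
    rw [hfdef]
    simp only
    rw [List.getD_eq_getElem _ _ (by omega)]
    simp only [hL', List.getElem_rotate]
    rw [← hk0]
    congr 1
    simp [Nat.mod_eq_of_lt hk]
  have hback : L = L'.rotate (n - k) := by
    rw [hL', List.rotate_rotate, Nat.add_sub_cancel' (by omega), ← hlen, List.rotate_length]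
  have hEk := hE k
  have hmem1 : s(f 0, f 1) ∈ cycleEdges n g := by
    apply hEk
    refine Finset.mem_image.2 ⟨0, by simp; omega, ?_⟩
    rw [Nat.mod_eq_of_lt (by omega)]
  obtain ⟨j, hj, hs⟩ := Finset.mem_image.1 hmem1
  simp only [Finset.mem_range] at hj
  have hj' : (j + 1) % n < n := Nat.mod_lt _ (by omega)
  have h0n : 0 ∈ Set.Iio n := by simp; omega
  rw [hf0] at hs
  rcases Sym2.eq_iff.1 hs with ⟨a, b⟩ | ⟨a, b⟩
  · have := hg hj h0n a
    subst this
    rw [Nat.mod_eq_of_lt (by omega)] at b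
    have hall := eq_of_cycleEdges_subset hf hg hEk hf0 b.symm
    refine ⟨n - k, Or.inl ?_⟩
    rw [hback, hLf]
    congr 1
    exact List.map_congr_left fun i hi => hall i (by simpa using hi)
  · have e0 := hg hj' h0n b
    have hjn : j = n - 1 := by
      rcases succ_mod_cases hj with h | h <;> omega
    have hall := eq_of_cycleEdges_subset hf (reverse_rotate_one_injOn hg)
      (by rw [cycleEdges_reflect]; exact hEk)
      (by simp [hf0])
      (by rw [← a, hjn, Nat.mod_eq_of_lt (by omega)])
    have hL2 : L' = (((List.range n).map g).rotate 1).reverse := by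
      rw [rotate_one_reverse_map_range, hLf]
      exact List.map_congr_left fun i hi => hall i (by simpa using hi)
    rw [hback, hL2, List.rotate_reverse, List.rotate_rotate]
    exact ⟨_, Or.inr rfl⟩

theorem cycleEdges_rotate {α : Type*} [DecidableEq α] {n : ℕ} (f : ℕ → α) (r : ℕ) :
    cycleEdges n (fun i => f ((i + r) % n)) ⊆ cycleEdges n f := by
  intro e he
  obtain ⟨i, hi, rfl⟩ := Finset.mem_image.1 he
  simp only [Finset.mem_range] at hi
  refine Finset.mem_image.2 ⟨(i + r) % n, by simpa using Nat.mod_lt _ (by omega), ?_⟩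
  have : ((i + 1) % n + r) % n = ((i + r) % n + 1) % n := by
    rw [Nat.mod_add_mod, Nat.mod_add_mod]; congr 1; ring
  simp only [this]

/-- If vertex potentials make the excess `dist p q - α p - α q` positive on the edges of a cycle
and negative on all other pairs, then the cycle is the unique longest one. -/
theorem unique_longest_of_excess {n : ℕ} (hn : 3 ≤ n) {P : ℕ → Pt}
    (hP : Set.InjOn P (Set.Iio n)) (a : ℕ → ℝ)
    (hadj : ∀ i < n, a i + a ((i + 1) % n) < dist (P i) (P ((i + 1) % n)))
    (hnon : ∀ i < n, ∀ j < n, i ≠ j → j ≠ (i + 1) % n → i ≠ (j + 1) % n →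
      dist (P i) (P j) < a i + a j) :
    let C := (List.range n).map P
    (∀ L : List Pt, IsHamCycleOn C.toFinset L → ecycleLen L ≤ ecycleLen C) ∧
      ∀ L : List Pt, IsHamCycleOn C.toFinset L → ecycleLen C ≤ ecycleLen L →
        ∃ r : ℕ, L = C.rotate r ∨ L = (C.rotate r).reverse := by
  intro C
  set α : Pt → ℝ := fun p => a (Function.invFunOn P (Set.Iio n) p) with hα
  have hαP : ∀ i < n, α (P i) = a i := fun i hi => congrArg a (hP.leftInvOn_invFunOn hi)
  let c : Sym2 Pt → ℝ := Sym2.lift ⟨fun p q => dist p q - α p - α q, fun p q => by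
    simp only [dist_comm p q]; ring⟩
  have hc : ∀ p q, c s(p, q) = dist p q - α p - α q := fun p q => rfl
  have hpos : ∀ e ∈ cycleEdges n P, 0 < c e := by
    intro e he
    obtain ⟨i, hi, rfl⟩ := Finset.mem_image.1 he
    simp only [Finset.mem_range] at hi
    have := hadj i hi
    rw [hc, hαP i hi, hαP _ (Nat.mod_lt _ (by omega))]
    linarith
  have hClen : C.length = n := by simp [C]
  have hCnd : C.Nodup :=
    List.nodup_range.map_on fun i hi j hj h => hP (by simpa using hi) (by simpa using hj) h
  have hlist : ∀ L : List Pt, IsHamCycleOn C.toFinset L → L.length = n := by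
    rintro L ⟨h1, h2⟩
    rw [← List.toFinset_card_of_nodup h1, h2, List.toFinset_card_of_nodup hCnd, hClen]
  have hneg : ∀ (f : ℕ → Pt), Set.InjOn f (Set.Iio n) →
      ((List.range n).map f).toFinset = C.toFinset →
      ∀ e ∈ cycleEdges n f, e ∉ cycleEdges n P → c e < 0 := by
    intro f hf hfC e he hne
    obtain ⟨k, hk, rfl⟩ := Finset.mem_image.1 he
    simp only [Finset.mem_range] at hk
    have hk' : (k + 1) % n < n := Nat.mod_lt _ (by omega)
    have hmem : ∀ k < n, ∃ i < n, P i = f k := by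
      intro k hk
      have : f k ∈ C.toFinset := by
        rw [← hfC]; simp only [List.mem_toFinset, List.mem_map, List.mem_range]
        exact ⟨k, hk, rfl⟩
      simpa [C] using this
    obtain ⟨i, hi, hik⟩ := hmem k hk
    obtain ⟨j, hj, hjk⟩ := hmem _ hk'
    rw [← hik, ← hjk] at hne ⊢
    have := hnon i hi j hj ?_ ?_ ?_
    · rw [hc, hαP i hi, hαP j hj]; linarith
    · rintro rfl
      have := hf hk hk' (hik.symm.trans hjk)
      rcases succ_mod_cases hk with h | h <;> omega
    · rintro rfl
      exact hne (Finset.mem_image.2 ⟨i, by simpa using hi, rfl⟩)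
    · rintro rfl
      exact hne (Finset.mem_image.2 ⟨j, by simpa using hj, Sym2.eq_swap⟩)
  have hsplit : ∀ f : ℕ → Pt, ∑ e ∈ cycleEdges n f, c e =
      ∑ e ∈ cycleEdges n f ∩ cycleEdges n P, c e + ∑ e ∈ cycleEdges n f \ cycleEdges n P, c e :=
    fun f => (Finset.sum_inter_add_sum_sdiff _ _ _).symm
  have hinter : ∀ f : ℕ → Pt,
      ∑ e ∈ cycleEdges n f ∩ cycleEdges n P, c e ≤ ∑ e ∈ cycleEdges n P, c e := fun f =>
    Finset.sum_le_sum_of_subset_of_nonneg Finset.inter_subset_right fun e he _ => (hpos e he).le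
  have hlenC := ecycleLen_eq_sum_excess hn hP α c hc
  have hdata : ∀ L : List Pt, IsHamCycleOn C.toFinset L →
      L = (List.range n).map (fun i => L.getD i 0) ∧
      Set.InjOn (fun i => L.getD i 0) (Set.Iio n) := by
    intro L hL
    have h1 : L = (List.range n).map (fun i => L.getD i 0) := by
      conv_lhs => rw [← map_range_getD L 0, hlist L hL]
    exact ⟨h1, injOn_of_nodup_map_range (h1 ▸ hL.1)⟩
  have hmain : ∀ L : List Pt, IsHamCycleOn C.toFinset L → ecycleLen L ≤ ecycleLen C ∧
      (ecycleLen C ≤ ecycleLen L → cycleEdges n (fun i => L.getD i 0) ⊆ cycleEdges n P) := by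
    intro L hL
    obtain ⟨h1, hf⟩ := hdata L hL
    set f : ℕ → Pt := fun i => L.getD i 0
    have hfC : ((List.range n).map f).toFinset = C.toFinset := h1 ▸ hL.2
    have hlenL := ecycleLen_eq_sum_excess hn hf α c hc
    rw [← h1] at hlenL
    rw [hlenL, hL.2, hlenC, hsplit f]
    have hi := hinter f
    have hng : ∀ e ∈ cycleEdges n f \ cycleEdges n P, c e < 0 := fun e he =>
      hneg f hf hfC e (Finset.mem_sdiff.1 he).1 (Finset.mem_sdiff.1 he).2
    have hs : ∑ e ∈ cycleEdges n f \ cycleEdges n P, c e ≤ 0 :=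
      Finset.sum_nonpos fun e he => (hng e he).le
    refine ⟨by simp only [C]; linarith, fun hle e he => ?_⟩
    by_contra hne
    have : ∑ e ∈ cycleEdges n f \ cycleEdges n P, c e < 0 :=
      Finset.sum_neg hng ⟨e, Finset.mem_sdiff.2 ⟨he, hne⟩⟩
    simp only [C] at hle
    linarith
  refine ⟨fun L hL => (hmain L hL).1, fun L hL hle => ?_⟩
  refine eq_rotate_or_reverse_of_edges hn hP hL.1 (hlist L hL) ?_ fun r => ?_
  · rw [← List.mem_toFinset, hL.2]
    simp only [C, List.mem_toFinset, List.mem_map, List.mem_range]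
    exact ⟨0, by omega, rfl⟩
  · refine subset_trans ?_ ((hmain L hL).2 hle)
    refine subset_trans (subset_of_eq ?_) (cycleEdges_rotate _ r)
    refine Finset.image_congr fun i hi => ?_
    simp only [Finset.coe_range, Set.mem_Iio] at hi
    have key : ∀ i < n, (L.rotate r).getD i 0 = L.getD ((i + r) % n) 0 := by
      intro i hi
      have hlen := hlist L hL
      rw [List.getD_eq_getElem _ _ (by simpa [hlen] using hi),
        List.getD_eq_getElem _ _ (by rw [hlen]; exact Nat.mod_lt _ (by omega)),
        List.getElem_rotate]
      simp [hlen]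
    simp only [key i hi, key _ (Nat.mod_lt (i + 1) (show 0 < n by omega))]

/-- Twice the signed area of the triangle on the vertices `i`, `j`, `k`. -/
def signedArea (x y : ℕ → ℝ) (i j k : ℕ) : ℝ :=
  (x j - x i) * (y k - y i) - (y j - y i) * (x k - x i)

theorem disjoint_openSegment_of_signedArea {x y : ℕ → ℝ} {ε : ℝ} (hε : 0 < ε) {i i' j j' : ℕ}
    (h : 0 ≤ signedArea x y i i' j * signedArea x y i i' j')
    (h' : signedArea x y i i' j + signedArea x y i i' j' ≠ 0) :
    openSegment ℝ (!₂[x i, ε * y i] : Pt) !₂[x i', ε * y i'] ∩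
      openSegment ℝ (!₂[x j, ε * y j] : Pt) !₂[x j', ε * y j'] = ∅ := by
  rw [Set.eq_empty_iff_forall_notMem]
  rintro p ⟨⟨s, t, hs, ht, hst, hp⟩, ⟨u, v, hu, hv, huv, hp'⟩⟩
  have e0 := congrFun (congrArg WithLp.ofLp (hp.trans hp'.symm)) 0
  have e1 := congrFun (congrArg WithLp.ofLp (hp.trans hp'.symm)) 1
  simp at e0 e1
  have e1' : s * y i + t * y i' = u * y j + v * y j' := by
    apply mul_left_cancel₀ hε.ne'; linarith
  obtain rfl : s = 1 - t := by linarith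
  obtain rfl : u = 1 - v := by linarith
  have key : (1 - v) * signedArea x y i i' j + v * signedArea x y i i' j' = 0 := by
    unfold signedArea
    linear_combination (y i' - y i) * e0 - (x i' - x i) * e1'
  generalize signedArea x y i i' j = A at *
  generalize signedArea x y i i' j' = B at *
  apply h'
  have h3 : (1 - v) ^ 2 * A ^ 2 + v * (1 - v) * (A * B) = 0 := by
    linear_combination (1 - v) * A * key
  have h4 : v ^ 2 * B ^ 2 + v * (1 - v) * (A * B) = 0 := by
    linear_combination v * B * key
  have h5 : 0 ≤ v * (1 - v) * (A * B) := by positivity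
  have hA : (1 - v) ^ 2 * A ^ 2 = 0 := by nlinarith [mul_nonneg (sq_nonneg (1 - v)) (sq_nonneg A)]
  have hB : v ^ 2 * B ^ 2 = 0 := by nlinarith [mul_nonneg (sq_nonneg v) (sq_nonneg B)]
  have hA' : A = 0 := by simpa [hu.ne'] using hA
  have hB' : B = 0 := by simpa [hv.ne'] using hB
  rw [hA', hB', add_zero]

theorem dist_vec (a b c d : ℝ) :
    dist (!₂[a, b] : Pt) !₂[c, d] = √((a - c) ^ 2 + (b - d) ^ 2) := by
  simp [EuclideanSpace.dist_eq, Fin.sum_univ_two, Real.dist_eq, sq_abs]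

open Filter Topology in
theorem eventually_lt_dist {x x' y y' b b' : ℝ} (hx : x * x' ≤ 0)
    (h : (b + b') * (|x| + |x'|) < (y - y') ^ 2) :
    ∀ᶠ ε in 𝓝[>] (0 : ℝ), (|x| + ε ^ 2 * b / 2) + (|x'| + ε ^ 2 * b' / 2) <
      dist (!₂[x, ε * y] : Pt) !₂[x', ε * y'] := by
  have hT : Tendsto (fun ε : ℝ => ε ^ 2 * (b + b') ^ 2 / 4 + (b + b') * (|x| + |x'|)) (𝓝[>] 0)
      (𝓝 (0 ^ 2 * (b + b') ^ 2 / 4 + (b + b') * (|x| + |x'|))) :=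
    Tendsto.mono_left (Continuous.tendsto (by fun_prop) _) nhdsWithin_le_nhds
  have hT' := hT.eventually_lt_const (u := (y - y') ^ 2) (by linarith)
  filter_upwards [hT', self_mem_nhdsWithin] with ε h1 h2
  have hε : 0 < ε := h2
  rw [dist_vec]
  apply Real.lt_sqrt_of_sq_lt
  have e : (x - x') ^ 2 = (|x| + |x'|) ^ 2 := by
    have : |x| * |x'| = -(x * x') := by rw [← abs_mul, abs_of_nonpos hx]
    nlinarith [sq_abs x, sq_abs x']
  rw [e]
  nlinarith [mul_lt_mul_of_pos_left h1 (pow_pos hε 2)]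

open Filter Topology in
theorem eventually_dist_lt {x x' y y' b b' : ℝ}
    (h : 0 < x * x' ∨ (x * x' ≤ 0 ∧ (y - y') ^ 2 < (b + b') * (|x| + |x'|))) :
    ∀ᶠ ε in 𝓝[>] (0 : ℝ), dist (!₂[x, ε * y] : Pt) !₂[x', ε * y'] <
      (|x| + ε ^ 2 * b / 2) + (|x'| + ε ^ 2 * b' / 2) := by
  rcases h with h | ⟨hx, h⟩
  · have hT : Tendsto (fun ε : ℝ => √((x - x') ^ 2 + (ε * y - ε * y') ^ 2) -
        ((|x| + ε ^ 2 * b / 2) + (|x'| + ε ^ 2 * b' / 2))) (𝓝[>] 0)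
        (𝓝 (√((x - x') ^ 2 + (0 * y - 0 * y') ^ 2) -
        ((|x| + 0 ^ 2 * b / 2) + (|x'| + 0 ^ 2 * b' / 2)))) :=
      Tendsto.mono_left (Continuous.tendsto (by fun_prop) _) nhdsWithin_le_nhds
    have hx0 : x ≠ 0 := by rintro rfl; simp at h
    have hx0' : x' ≠ 0 := by rintro rfl; simp at h
    have hlt : |x - x'| < |x| + |x'| := by
      apply abs_lt_of_sq_lt_sq _ (by positivity)
      have : |x| * |x'| = x * x' := by rw [← abs_mul, abs_of_pos h]
      nlinarith [sq_abs x, sq_abs x']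
    have hT' := hT.eventually_lt_const (u := 0) (by
      simp only [zero_mul, sub_zero, ne_eq, OfNat.ofNat_ne_zero, not_false_eq_true, zero_pow,
        add_zero, zero_div, Real.sqrt_sq_eq_abs]
      linarith)
    filter_upwards [hT'] with ε h1
    rw [dist_vec]
    linarith
  · have hpos : 0 < |x| + |x'| := by
      rcases (add_nonneg (abs_nonneg x) (abs_nonneg x')).eq_or_lt with h0 | h0
      · rw [← h0, mul_zero] at h
        exact absurd h (not_lt.2 (sq_nonneg _))
      · exact h0
    have hb : 0 < b + b' := pos_of_mul_pos_left ((sq_nonneg _).trans_lt h) hpos.le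
    filter_upwards [self_mem_nhdsWithin] with ε h2
    have hε : 0 < ε := h2
    rw [dist_vec]
    have hεb : 0 < ε ^ 2 * (b + b') := by positivity
    apply (Real.sqrt_lt' (by nlinarith)).2
    have e : (x - x') ^ 2 = (|x| + |x'|) ^ 2 := by
      have : |x| * |x'| = -(x * x') := by rw [← abs_mul, abs_of_nonpos hx]
      nlinarith [sq_abs x, sq_abs x']
    rw [e]
    nlinarith [mul_lt_mul_of_pos_left h (pow_pos hε 2), sq_nonneg (ε ^ 2 * (b + b'))]

theorem signs_of_neg_one_pow_mul {i : ℕ} {A B : ℝ} (hA : 0 < (-1) ^ i * A)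
    (hB : 0 < (-1) ^ i * B) : 0 ≤ A * B ∧ A + B ≠ 0 := by
  rcases neg_one_pow_eq_or ℝ i with h | h <;> rw [h] at hA hB
  · exact ⟨by nlinarith, by linarith⟩
  · exact ⟨by nlinarith, by linarith⟩

theorem signedArea_self_right (x y : ℕ → ℝ) (i j : ℕ) : signedArea x y i j j = 0 := by
  unfold signedArea; ring

theorem signedArea_self_left (x y : ℕ → ℝ) (i j : ℕ) : signedArea x y i j i = 0 := by
  unfold signedArea; ring

theorem signedArea_rotate (x y : ℕ → ℝ) (i j k : ℕ) :
    signedArea x y j k i = signedArea x y i j k := by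
  unfold signedArea; ring

/-- Sign conditions on a plan `(x, y)` with second-order potentials `b` which guarantee that,
after flattening the plan vertically, its cycle is the unique longest one and noncrossing. -/
theorem exists_unique_longest_noncrossing {n : ℕ} (hn : 3 ≤ n) (x y b : ℕ → ℝ)
    (hadj : ∀ k, k + 1 < n → x k * x (k + 1) ≤ 0 ∧
      (b k + b (k + 1)) * (|x k| + |x (k + 1)|) < (y k - y (k + 1)) ^ 2)
    (hwrap : x (n - 1) * x 0 ≤ 0 ∧
      (b (n - 1) + b 0) * (|x (n - 1)| + |x 0|) < (y (n - 1) - y 0) ^ 2)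
    (hinj : ∀ i j, i < j → j < n → 0 < x i * x j → x i * y j ≠ x j * y i)
    (hnon : ∀ i j, i + 1 < j → j < n → ¬(i = 0 ∧ j = n - 1) → 0 < x i * x j ∨
      (x i * x j ≤ 0 ∧ (y i - y j) ^ 2 < (b i + b j) * (|x i| + |x j|)))
    (harea : ∀ i k, i + 1 < k → k < n → 0 < (-1) ^ i * signedArea x y i (i + 1) k)
    (harea_zero : ∀ i, 2 ≤ i → i + 1 < n → 0 < (-1) ^ i * signedArea x y i (i + 1) 0)
    (harea_last : 3 < n → 0 < signedArea x y (n - 1) 0 1 ∧ 0 < signedArea x y (n - 1) 0 2) :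
    ∃ S : Finset Pt, S.card = n ∧
      ∃ C : List Pt, IsHamCycleOn S C ∧
        (∀ L : List Pt, IsHamCycleOn S L → ecycleLen L ≤ ecycleLen C) ∧
        CycleNoncrossing C ∧
        (∀ L : List Pt, IsHamCycleOn S L →
          (∀ L' : List Pt, IsHamCycleOn S L' → ecycleLen L' ≤ ecycleLen L) →
          ∃ r : ℕ, L = C.rotate r ∨ L = (C.rotate r).reverse) := by
  have hadj' : ∀ i < n, x i * x ((i + 1) % n) ≤ 0 ∧
      (b i + b ((i + 1) % n)) * (|x i| + |x ((i + 1) % n)|) < (y i - y ((i + 1) % n)) ^ 2 := by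
    intro i hi
    rcases succ_mod_cases hi with ⟨h, e⟩ | ⟨h, e⟩ <;> rw [e]
    · exact hadj i h
    · obtain rfl : i = n - 1 := by omega
      exact hwrap
  have hnon' : ∀ i < n, ∀ j < n, i ≠ j → j ≠ (i + 1) % n → i ≠ (j + 1) % n →
      0 < x i * x j ∨ (x i * x j ≤ 0 ∧ (y i - y j) ^ 2 < (b i + b j) * (|x i| + |x j|)) := by
    intro i hi j hj hij h1 h2
    rcases Nat.lt_or_gt_of_ne hij with h | h
    · apply hnon i j _ hj
      · rintro ⟨rfl, rfl⟩
        rcases succ_mod_cases hj with ⟨h, e⟩ | ⟨h, e⟩ <;> omega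
      · rcases succ_mod_cases hi with ⟨h, e⟩ | ⟨h, e⟩ <;> omega
    · have := hnon j i ?_ hi ?_
      · rwa [mul_comm (x i), add_comm (b i), add_comm |x i|, ← neg_sub (y j), neg_sq]
      · rcases succ_mod_cases hj with ⟨h, e⟩ | ⟨h, e⟩ <;> omega
      · rintro ⟨rfl, rfl⟩
        rcases succ_mod_cases hi with ⟨h, e⟩ | ⟨h, e⟩ <;> omega
  obtain ⟨ε, hε, hlt, hgt⟩ : ∃ ε : ℝ, 0 < ε ∧
      (∀ i < n, (|x i| + ε ^ 2 * b i / 2) +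
        (|x ((i + 1) % n)| + ε ^ 2 * b ((i + 1) % n) / 2) <
        dist (!₂[x i, ε * y i] : Pt) !₂[x ((i + 1) % n), ε * y ((i + 1) % n)]) ∧
      (∀ i < n, ∀ j < n, i ≠ j → j ≠ (i + 1) % n → i ≠ (j + 1) % n →
        dist (!₂[x i, ε * y i] : Pt) !₂[x j, ε * y j] <
          (|x i| + ε ^ 2 * b i / 2) + (|x j| + ε ^ 2 * b j / 2)) := by
    have e1 := (Set.finite_Iio n).eventually_all.2 fun i (hi : i ∈ Set.Iio n) =>
      eventually_lt_dist (hadj' i hi).1 (hadj' i hi).2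
    have e2 := (Set.finite_Iio n).eventually_all.2 fun i (hi : i ∈ Set.Iio n) =>
      (Set.finite_Iio n).eventually_all.2 fun j (hj : j ∈ Set.Iio n) =>
      Filter.eventually_imp_distrib_left.2 fun h1 : i ≠ j =>
      Filter.eventually_imp_distrib_left.2 fun h2 : j ≠ (i + 1) % n =>
      Filter.eventually_imp_distrib_left.2 fun h3 : i ≠ (j + 1) % n =>
      eventually_dist_lt (hnon' i hi j hj h1 h2 h3)
    obtain ⟨ε, ⟨h1, h2⟩, h3⟩ := ((e1.and e2).and self_mem_nhdsWithin).exists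
    exact ⟨ε, h3, h1, h2⟩
  set P : ℕ → Pt := fun i => !₂[x i, ε * y i] with hPdef
  have hP : Set.InjOn P (Set.Iio n) := by
    have key : ∀ i j, i < j → j < n → P i ≠ P j := by
      intro i j hij hj h
      have e0 : x i = x j := by simpa [hPdef] using congrFun (congrArg WithLp.ofLp h) 0
      have e1 : y i = y j := by
        simpa [hPdef, hε.ne'] using congrFun (congrArg WithLp.ofLp h) 1
      by_cases hx : 0 < x i * x j
      · exact hinj i j hij hj hx (by rw [e0, e1])
      · have hxj : x j = 0 := by
          rw [e0] at hx
          nlinarith [mul_self_nonneg (x j), mul_self_eq_zero.1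
            (le_antisymm (not_lt.1 hx) (mul_self_nonneg (x j)))]
        by_cases h1 : j = i + 1
        · have := (hadj i (h1 ▸ hj)).2
          rw [← h1] at this
          simp [e0, e1, hxj] at this
        · by_cases h2 : i = 0 ∧ j = n - 1
          · have := hwrap.2
            rw [← h2.1, ← h2.2] at this
            simp [e0, e1, hxj] at this
          · have := hnon i j (by omega) hj h2
            simp [e0, e1, hxj] at this
    intro i hi j hj h
    by_contra hne
    rcases Nat.lt_or_gt_of_ne hne with h' | h'
    · exact key i j h' hj h
    · exact key j i h' hi h.symm
  obtain ⟨hmax, huniq⟩ :=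
    unique_longest_of_excess hn hP (fun i => |x i| + ε ^ 2 * b i / 2) hlt hgt
  have hnd : ((List.range n).map P).Nodup :=
    List.nodup_range.map_on fun i hi j hj h => hP (by simpa using hi) (by simpa using hj) h
  have hcross : ∀ i j, i < j → j < n →
      openSegment ℝ (P i) (P ((i + 1) % n)) ∩ openSegment ℝ (P j) (P ((j + 1) % n)) = ∅ := by
    intro i j hij hj
    have hi1 : (i + 1) % n = i + 1 := Nat.mod_eq_of_lt (by omega)
    rw [hi1]
    rcases succ_mod_cases hj with ⟨h, e⟩ | ⟨h, e⟩ <;> rw [e]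
    · have hB := harea i (j + 1) (by omega) h
      by_cases hji : j = i + 1
      · subst hji
        apply disjoint_openSegment_of_signedArea hε
        · rw [signedArea_self_right, zero_mul]
        · rw [signedArea_self_right, zero_add]
          exact right_ne_zero_of_mul hB.ne'
      · obtain ⟨h1, h2⟩ := signs_of_neg_one_pow_mul (harea i j (by omega) hj) hB
        exact disjoint_openSegment_of_signedArea hε h1 h2
    · obtain rfl : j = n - 1 := by omega
      by_cases hi0 : i = 0
      · subst hi0
        have hB := harea 0 (n - 1) (by omega) hj
        apply disjoint_openSegment_of_signedArea hε
        · rw [signedArea_self_left, mul_zero]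
        · rw [signedArea_self_left, add_zero]
          exact right_ne_zero_of_mul hB.ne'
      by_cases hin : n - 1 = i + 1
      · have hne : signedArea x y i (i + 1) 0 ≠ 0 := by
          by_cases hi' : i = 1
          · subst hi'
            rw [signedArea_rotate]
            exact right_ne_zero_of_mul (harea 0 2 (by omega) (by omega)).ne'
          · exact right_ne_zero_of_mul (harea_zero i (by omega) (by omega)).ne'
        rw [hin]
        apply disjoint_openSegment_of_signedArea hε
        · rw [signedArea_self_right, zero_mul]
        · rwa [signedArea_self_right, zero_add]
      · by_cases hi' : i = 1
        · subst hi'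
          obtain ⟨h1, h2⟩ := harea_last (by omega)
          rw [Set.inter_comm]
          exact disjoint_openSegment_of_signedArea hε (mul_nonneg h1.le h2.le) (by positivity)
        · obtain ⟨h1, h2⟩ := signs_of_neg_one_pow_mul (harea i (n - 1) (by omega) hj)
            (harea_zero i (by omega) (by omega))
          exact disjoint_openSegment_of_signedArea hε h1 h2
  refine ⟨((List.range n).map P).toFinset, ?_, (List.range n).map P, ⟨hnd, rfl⟩, hmax, ?_,
    fun L hL hLmax => huniq L hL (hLmax _ ⟨hnd, rfl⟩)⟩
  · rw [List.toFinset_card_of_nodup hnd]; simp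
  · intro e₁ h₁ e₂ h₂ hne
    rw [zip_rotate_map_range] at h₁ h₂
    obtain ⟨i, hi, rfl⟩ := List.mem_map.1 h₁
    obtain ⟨j, hj, rfl⟩ := List.mem_map.1 h₂
    rw [List.mem_range] at hi hj
    rcases lt_trichotomy i j with h | h | h
    · exact hcross i j h hj
    · exact absurd (by rw [h]) hne
    · rw [Set.inter_comm]; exact hcross j i h hi

/-- Alternate between the terms of two sequences. -/
def interleave (f g : ℕ → ℝ) (k : ℕ) : ℝ := if k % 2 = 0 then f (k / 2) else g (k / 2)

theorem interleave_even (f g : ℕ → ℝ) (i : ℕ) : interleave f g (2 * i) = f i := by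
  simp [interleave]

theorem interleave_odd (f g : ℕ → ℝ) (i : ℕ) : interleave f g (2 * i + 1) = g i := by
  have h1 : (2 * i + 1) % 2 = 1 := by omega
  have h2 : (2 * i + 1) / 2 = i := by omega
  simp [interleave, h1, h2]

/-- Slope of the ray from the origin carrying the `j`-th right vertex of the zigzag. -/
def raySlope (A : ℝ) (j : ℕ) : ℝ := A + 4 * 2 ^ j

/-- Slope of the line through the origin carrying the `i`-th left vertex of the zigzag. -/
noncomputable def leftSlope (A E : ℝ) (i : ℕ) : ℝ :=
  if i = 0 then A + 4 + 1 / E else raySlope A i + 1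

/-- Horizontal distance to the origin of the `i`-th left vertex of the zigzag. -/
noncomputable def leftDist (M : ℕ) (E : ℝ) (i : ℕ) : ℝ :=
  if i = 0 then E else ((32 * 2 ^ M) ^ i)⁻¹

/-- Square of the angular threshold of the `i`-th left vertex of the zigzag. -/
def leftGap (i : ℕ) : ℝ := if i = 0 then 1 else 9 * 4 ^ i

/-- The left vertices, at even indices, and the right vertices, at odd indices, of a zigzag,
together with their second-order potentials `b`. -/
structure IsZigzag (M : ℕ) (A E : ℝ) (R x y b : ℕ → ℝ) : Prop where
  le_E : 2 * 2 ^ M ≤ E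
  le_R : ∀ j ≤ M, 2 * 2 ^ M ≤ R j
  R_zero : R 0 = E
  x_left : ∀ i ≤ M, x (2 * i) = -leftDist M E i
  y_left : ∀ i ≤ M, y (2 * i) = -(leftDist M E i * leftSlope A E i)
  b_left : ∀ i ≤ M, b (2 * i) = leftDist M E i * (leftSlope A E i ^ 2 - leftGap i)
  x_right : ∀ j ≤ M, x (2 * j + 1) = R j
  y_right : ∀ j ≤ M, y (2 * j + 1) = raySlope A j * R j
  b_right : ∀ j ≤ M, b (2 * j + 1) = raySlope A j ^ 2 * R j

theorem raySlope_zero (A : ℝ) : raySlope A 0 = A + 4 := by simp [raySlope]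

theorem raySlope_add_four_le (A : ℝ) {j l : ℕ} (h : j < l) :
    raySlope A j + 4 ≤ raySlope A l := by
  have h1 : (2 : ℝ) ^ (j + 1) ≤ 2 ^ l := pow_le_pow_right₀ (by norm_num) h
  have h2 : (1 : ℝ) ≤ 2 ^ j := one_le_pow₀ (by norm_num)
  unfold raySlope
  rw [pow_succ] at h1
  linarith

theorem raySlope_mono (A : ℝ) {j l : ℕ} (h : j ≤ l) : raySlope A j ≤ raySlope A l := by
  rcases h.eq_or_lt with rfl | h
  · exact le_rfl
  · linarith [raySlope_add_four_le A h]

theorem leftSlope_of_pos (A E : ℝ) {i : ℕ} (h : 1 ≤ i) : leftSlope A E i = raySlope A i + 1 := by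
  rw [leftSlope, if_neg (by omega)]

theorem leftSlope_zero (A E : ℝ) : leftSlope A E 0 = A + 4 + 1 / E := by simp [leftSlope]

theorem leftDist_zero (M : ℕ) (E : ℝ) : leftDist M E 0 = E := by simp [leftDist]

theorem leftDist_pos (M : ℕ) {E : ℝ} (hE : 0 < E) (i : ℕ) : 0 < leftDist M E i := by
  unfold leftDist; split_ifs <;> positivity

theorem leftDist_mul_le (M : ℕ) (E : ℝ) {i l : ℕ} (hi : 1 ≤ i) (h : i < l) :
    leftDist M E l * (32 * 2 ^ M) ≤ leftDist M E i := by
  have h1 : (1 : ℝ) ≤ 2 ^ M := one_le_pow₀ (by norm_num)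
  have hK : (0 : ℝ) < 32 * 2 ^ M := by positivity
  rw [leftDist, leftDist, if_neg (by omega), if_neg (by omega)]
  have h2 : ((32 * 2 ^ M : ℝ) ^ l)⁻¹ * (32 * 2 ^ M) ≤
      ((32 * 2 ^ M : ℝ) ^ (i + 1))⁻¹ * (32 * 2 ^ M) := by
    gcongr
    · linarith
    · exact h
  refine h2.trans (le_of_eq ?_)
  rw [pow_succ]
  field_simp

theorem leftDist_mul_le_one (M : ℕ) (E : ℝ) {i : ℕ} (hi : 1 ≤ i) :
    leftDist M E i * (32 * 2 ^ M) ≤ 1 := by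
  have h1 : (1 : ℝ) ≤ 2 ^ M := one_le_pow₀ (by norm_num)
  have hK : (0 : ℝ) < 32 * 2 ^ M := by positivity
  rw [leftDist, if_neg (by omega)]
  have h2 : ((32 * 2 ^ M : ℝ) ^ i)⁻¹ * (32 * 2 ^ M) ≤
      ((32 * 2 ^ M : ℝ) ^ 1)⁻¹ * (32 * 2 ^ M) := by
    gcongr
    linarith
  refine h2.trans (le_of_eq ?_)
  rw [pow_one]
  field_simp

theorem signedArea_swap (x y : ℕ → ℝ) (i j k : ℕ) :
    signedArea x y j i k = -signedArea x y i j k := by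
  unfold signedArea; ring

theorem signedArea_swap_neg_one_pow (x y : ℕ → ℝ) (p j k : ℕ) :
    signedArea x y j (2 * p + 1) k = (-1) ^ (2 * p + 1) * signedArea x y (2 * p + 1) j k := by
  rw [signedArea_swap, (odd_two_mul_add_one p).neg_one_pow]; ring

theorem edge_of_lt {r s d R a : ℝ} (hr : 0 < r) (hR : 0 < R)
    (h : R * (a - s) ^ 2 < d * (R + r)) :
    -r * R ≤ 0 ∧ (r * (s ^ 2 - d) + a ^ 2 * R) * (|-r| + |R|) < (-(r * s) - a * R) ^ 2 := by
  refine ⟨by nlinarith [mul_pos hr hR], ?_⟩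
  rw [abs_neg, abs_of_pos hr, abs_of_pos hR]
  nlinarith [mul_lt_mul_of_pos_left h hr]

theorem nonedge_of_lt {r s d R a : ℝ} (hr : 0 < r) (hR : 0 < R)
    (h : d * (R + r) < R * (a - s) ^ 2) :
    -r * R ≤ 0 ∧ (-(r * s) - a * R) ^ 2 < (r * (s ^ 2 - d) + a ^ 2 * R) * (|-r| + |R|) := by
  refine ⟨by nlinarith [mul_pos hr hR], ?_⟩
  rw [abs_neg, abs_of_pos hr, abs_of_pos hR]
  nlinarith [mul_lt_mul_of_pos_left h hr]

theorem sub_leftSlope_sq_lt (A E : ℝ) {i j : ℕ} (hi : 1 ≤ i) (hj : j = i ∨ j + 1 = i) :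
    (raySlope A j - leftSlope A E i) ^ 2 < leftGap i := by
  rw [leftSlope_of_pos A E hi, leftGap, if_neg (by omega)]
  have h4 : (4 : ℝ) ^ i = 2 ^ i * 2 ^ i := by rw [← mul_pow]; norm_num
  have h2 : (2 : ℝ) ^ 1 ≤ 2 ^ i := pow_le_pow_right₀ (by norm_num) hi
  rw [h4]
  unfold raySlope
  rcases hj with rfl | rfl
  · nlinarith
  · have e : (2 : ℝ) ^ (j + 1) = 2 ^ j * 2 := pow_succ _ _
    rw [e] at h2 ⊢
    nlinarith

theorem leftGap_add_lt (A E : ℝ) {i j : ℕ} (hi : 1 ≤ i) (hj : j ≠ i) (hj' : j + 1 ≠ i) :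
    leftGap i + 6 * 2 ^ i < (raySlope A j - leftSlope A E i) ^ 2 := by
  rw [leftSlope_of_pos A E hi, leftGap, if_neg (by omega)]
  have h4 : (4 : ℝ) ^ i = 2 ^ i * 2 ^ i := by rw [← mul_pow]; norm_num
  have h2 : (2 : ℝ) ^ 1 ≤ 2 ^ i := pow_le_pow_right₀ (by norm_num) hi
  rw [h4]
  unfold raySlope
  rcases Nat.lt_or_gt_of_ne hj with h | h
  · have h5 : (2 : ℝ) ^ (j + 2) ≤ 2 ^ i := pow_le_pow_right₀ (by norm_num) (by omega)
    rw [pow_add] at h5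
    nlinarith
  · have h5 : (2 : ℝ) ^ (i + 1) ≤ 2 ^ j := pow_le_pow_right₀ (by norm_num) (by omega)
    rw [pow_add] at h5
    nlinarith

namespace IsZigzag

variable {M : ℕ} {A E : ℝ} {R x y b : ℕ → ℝ}

theorem E_pos (h : IsZigzag M A E R x y b) : 0 < E := lt_of_lt_of_le (by positivity) h.le_E

theorem two_le_E (h : IsZigzag M A E R x y b) : 2 ≤ E := by
  have h1 : (1 : ℝ) ≤ 2 ^ M := one_le_pow₀ (by norm_num)
  linarith [h.le_E]

theorem R_pos (h : IsZigzag M A E R x y b) {j : ℕ} (hj : j ≤ M) : 0 < R j :=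
  lt_of_lt_of_le (by positivity) (h.le_R j hj)

theorem two_le_R (h : IsZigzag M A E R x y b) {j : ℕ} (hj : j ≤ M) : 2 ≤ R j := by
  have h1 : (1 : ℝ) ≤ 2 ^ M := one_le_pow₀ (by norm_num)
  linarith [h.le_R j hj]

theorem one_div_E_le (h : IsZigzag M A E R x y b) : 1 / E ≤ 1 / 2 :=
  one_div_le_one_div_of_le (by norm_num) h.two_le_E

theorem one_div_E_pos (h : IsZigzag M A E R x y b) : 0 < 1 / E := one_div_pos.2 h.E_pos

theorem edge (h : IsZigzag M A E R x y b) {i j : ℕ} (hi : i ≤ M) (hj : j ≤ M)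
    (hlt : R j * (raySlope A j - leftSlope A E i) ^ 2 <
      leftGap i * (R j + leftDist M E i)) :
    x (2 * i) * x (2 * j + 1) ≤ 0 ∧
      (b (2 * i) + b (2 * j + 1)) * (|x (2 * i)| + |x (2 * j + 1)|) <
        (y (2 * i) - y (2 * j + 1)) ^ 2 := by
  rw [h.x_left i hi, h.y_left i hi, h.b_left i hi, h.x_right j hj, h.y_right j hj, h.b_right j hj]
  exact edge_of_lt (leftDist_pos M h.E_pos i) (h.R_pos hj) hlt

theorem nonedge (h : IsZigzag M A E R x y b) {i j : ℕ} (hi : i ≤ M) (hj : j ≤ M)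
    (hlt : leftGap i * (R j + leftDist M E i) <
      R j * (raySlope A j - leftSlope A E i) ^ 2) :
    x (2 * i) * x (2 * j + 1) ≤ 0 ∧
      (y (2 * i) - y (2 * j + 1)) ^ 2 <
        (b (2 * i) + b (2 * j + 1)) * (|x (2 * i)| + |x (2 * j + 1)|) := by
  rw [h.x_left i hi, h.y_left i hi, h.b_left i hi, h.x_right j hj, h.y_right j hj, h.b_right j hj]
  exact nonedge_of_lt (leftDist_pos M h.E_pos i) (h.R_pos hj) hlt

theorem edge_zigzag (h : IsZigzag M A E R x y b) {i j : ℕ} (hi : i ≤ M)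
    (hij : j = i ∨ j + 1 = i) :
    x (2 * i) * x (2 * j + 1) ≤ 0 ∧
      (b (2 * i) + b (2 * j + 1)) * (|x (2 * i)| + |x (2 * j + 1)|) <
        (y (2 * i) - y (2 * j + 1)) ^ 2 := by
  refine h.edge hi (by omega) ?_
  have hR := h.R_pos (show j ≤ M by omega)
  have hr := leftDist_pos M h.E_pos i
  rcases Nat.eq_zero_or_pos i with rfl | hi'
  · obtain rfl : j = 0 := by omega
    rw [raySlope_zero, leftSlope_zero, leftGap, if_pos rfl]
    have h1 := h.one_div_E_pos
    have h2 := h.one_div_E_le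
    have h3 : (1 / E) ^ 2 < 1 := by nlinarith
    nlinarith [mul_lt_mul_of_pos_left h3 hR]
  · have h1 := sub_leftSlope_sq_lt A E hi' hij
    have h2 : 0 < leftGap i := (sq_nonneg _).trans_lt h1
    nlinarith [mul_lt_mul_of_pos_left h1 hR, mul_pos h2 hr]

theorem nonedge_zigzag (h : IsZigzag M A E R x y b) {i j : ℕ} (hi : i ≤ M) (hj : j ≤ M)
    (hi1 : 1 ≤ i) (hij : j ≠ i) (hij' : j + 1 ≠ i) :
    x (2 * i) * x (2 * j + 1) ≤ 0 ∧
      (y (2 * i) - y (2 * j + 1)) ^ 2 <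
        (b (2 * i) + b (2 * j + 1)) * (|x (2 * i)| + |x (2 * j + 1)|) := by
  refine h.nonedge hi hj ?_
  have hR := h.le_R j hj
  have hR0 := h.R_pos hj
  have hr := leftDist_pos M h.E_pos i
  have h1 := leftGap_add_lt A E hi1 hij hij'
  have hpow : (2 : ℝ) ^ i ≤ 2 ^ M := pow_le_pow_right₀ (by norm_num) hi
  have h1i : (1 : ℝ) ≤ 2 ^ i := one_le_pow₀ (by norm_num)
  have h3 : leftGap i * leftDist M E i ≤ R j * (6 * 2 ^ i) := by
    have hg : leftGap i = 9 * (2 ^ i * 2 ^ i) := by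
      rw [leftGap, if_neg (by omega), ← mul_pow]; norm_num
    have hr1 : leftDist M E i ≤ 1 := by nlinarith [leftDist_mul_le_one M E hi1]
    rw [hg]
    calc 9 * ((2 : ℝ) ^ i * 2 ^ i) * leftDist M E i ≤ 9 * (2 ^ i * 2 ^ i) * 1 := by gcongr
      _ ≤ (2 * 2 ^ M) * (6 * 2 ^ i) := by nlinarith
      _ ≤ R j * (6 * 2 ^ i) := by gcongr
  nlinarith [mul_lt_mul_of_pos_left h1 hR0]

theorem nonedge_zero (h : IsZigzag M A E R x y b) {j : ℕ} (hj : j ≤ M) (hj1 : 1 ≤ j)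
    (hRj : R j = E) :
    x (2 * 0) * x (2 * j + 1) ≤ 0 ∧
      (y (2 * 0) - y (2 * j + 1)) ^ 2 <
        (b (2 * 0) + b (2 * j + 1)) * (|x (2 * 0)| + |x (2 * j + 1)|) := by
  refine h.nonedge (Nat.zero_le _) hj ?_
  rw [hRj, leftDist_zero, leftGap, if_pos rfl, leftSlope_zero]
  have h1 := raySlope_add_four_le A hj1
  rw [raySlope_zero] at h1
  have h2 := h.one_div_E_le
  have h3 : 9 ≤ (raySlope A j - (A + 4 + 1 / E)) ^ 2 := by nlinarith
  nlinarith [h.E_pos]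

theorem area_left (h : IsZigzag M A E R x y b) {i j l : ℕ} (hi : i ≤ M) (hj : j ≤ M)
    (hl : l ≤ M) :
    signedArea x y (2 * i) (2 * j + 1) (2 * l) =
      R j * leftDist M E i * (leftSlope A E i - raySlope A j) -
        R j * leftDist M E l * (leftSlope A E l - raySlope A j) +
        leftDist M E l * leftDist M E i * (leftSlope A E i - leftSlope A E l) := by
  rw [signedArea, h.x_left i hi, h.y_left i hi, h.x_left l hl, h.y_left l hl, h.x_right j hj,
    h.y_right j hj]
  ring

theorem area_right (h : IsZigzag M A E R x y b) {i j l : ℕ} (hi : i ≤ M) (hj : j ≤ M)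
    (hl : l ≤ M) :
    signedArea x y (2 * i) (2 * j + 1) (2 * l + 1) =
      R j * leftDist M E i * (leftSlope A E i - raySlope A j) +
        R j * R l * (raySlope A l - raySlope A j) -
        R l * leftDist M E i * (leftSlope A E i - raySlope A l) := by
  rw [signedArea, h.x_left i hi, h.y_left i hi, h.x_right l hl, h.y_right l hl, h.x_right j hj,
    h.y_right j hj]
  ring

theorem area_left_pos (h : IsZigzag M A E R x y b) {i j l : ℕ}
    (hij : j = i ∨ j + 1 = i) (hil : i < l) (hl : l ≤ M) :
    0 < signedArea x y (2 * i) (2 * j + 1) (2 * l) := by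
  rw [h.area_left (by omega) (by omega) hl]
  have hr := leftDist_pos M h.E_pos l
  have hq : (1 : ℝ) ≤ 2 ^ M := one_le_pow₀ (by norm_num)
  have hlM : (2 : ℝ) ^ l ≤ 2 ^ M := pow_le_pow_right₀ (by norm_num) hl
  have hsl := leftSlope_of_pos A E (show 1 ≤ l by omega)
  have hal : raySlope A l - raySlope A j ≤ 4 * 2 ^ M := by
    have : (0 : ℝ) < 2 ^ j := by positivity
    unfold raySlope; linarith
  rcases Nat.eq_zero_or_pos i with rfl | hi'
  · obtain rfl : j = 0 := by omega
    rw [hsl, h.R_zero, leftDist_zero, leftSlope_zero, raySlope_zero] at *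
    have h1 := leftDist_mul_le_one M E (show 1 ≤ l by omega)
    have e1 : E * E * (A + 4 + 1 / E - (A + 4)) = E := by
      have := h.E_pos.ne'
      field_simp
      ring
    rw [e1]
    have h2 : leftDist M E l * (2 * (raySlope A l + 1 - (A + 4))) ≤ 1 / 2 := by nlinarith
    have h3 := h.one_div_E_pos
    nlinarith [mul_le_mul_of_nonneg_left h2 h.E_pos.le, h.E_pos, mul_pos (mul_pos h3 hr) h.E_pos]
  · have hri := leftDist_pos M h.E_pos i
    have h1 := leftDist_mul_le M E hi' hil
    rw [hsl, leftSlope_of_pos A E hi']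
    have h2 : 1 ≤ raySlope A i + 1 - raySlope A j := by
      linarith [raySlope_mono A (show j ≤ i by omega)]
    have h3 : leftDist M E l * (raySlope A l + 1 - raySlope A j) ≤ leftDist M E i / 4 := by
      nlinarith
    have h4 : raySlope A l + 1 - (raySlope A i + 1) ≤ raySlope A l + 1 - raySlope A j := by
      linarith
    have hR := h.two_le_R (show j ≤ M by omega)
    have hri1 : leftDist M E i ≤ 1 := by nlinarith [leftDist_mul_le_one M E hi']
    have h5 : leftDist M E l * (raySlope A l + 1 - (raySlope A i + 1)) ≤ leftDist M E i / 4 :=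
      (mul_le_mul_of_nonneg_left h4 hr.le).trans h3
    have h6 : leftDist M E i ≤ leftDist M E i * (raySlope A i + 1 - raySlope A j) := by nlinarith
    have h7 : R j * (3 / 4 * leftDist M E i) ≤ R j *
      (leftDist M E i * (raySlope A i + 1 - raySlope A j) -
        leftDist M E l * (raySlope A l + 1 - raySlope A j)) := by
      gcongr; linarith
    have h8 : leftDist M E i * (leftDist M E l * (raySlope A l + 1 - (raySlope A i + 1))) ≤
        1 * (leftDist M E i / 4) := by
      calc _ ≤ leftDist M E i * (leftDist M E i / 4) := by gcongr
        _ ≤ _ := by gcongr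
    nlinarith

theorem area_right_pos (h : IsZigzag M A E R x y b) {i j l : ℕ}
    (hij : j = i ∨ j + 1 = i) (hi : i ≤ M) (hjl : j < l) (hl : l ≤ M) :
    0 < signedArea x y (2 * i) (2 * j + 1) (2 * l + 1) := by
  rw [h.area_right hi (by omega) hl]
  have hr := leftDist_pos M h.E_pos i
  have hRj := h.two_le_R (show j ≤ M by omega)
  have hRl := h.R_pos hl
  have ha := raySlope_add_four_le A hjl
  have h2 : 0 ≤ leftSlope A E i - raySlope A j := by
    rcases Nat.eq_zero_or_pos i with rfl | hi'
    · obtain rfl : j = 0 := by omega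
      rw [leftSlope_zero, raySlope_zero]
      linarith [h.one_div_E_pos]
    · rw [leftSlope_of_pos A E hi']
      linarith [raySlope_mono A (show j ≤ i by omega)]
  have h3 : leftDist M E i * (leftSlope A E i - raySlope A l) ≤ 1 := by
    rcases Nat.eq_zero_or_pos i with rfl | hi'
    · obtain rfl : j = 0 := by omega
      rw [raySlope_zero] at ha
      rw [leftSlope_zero]
      nlinarith [h.one_div_E_le]
    · rw [leftSlope_of_pos A E hi']
      have hq : (1 : ℝ) ≤ 2 ^ M := one_le_pow₀ (by norm_num)
      have hri1 : leftDist M E i ≤ 1 := by nlinarith [leftDist_mul_le_one M E hi']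
      nlinarith [raySlope_mono A (show i ≤ l by omega)]
  have h4 : 0 ≤ R j * leftDist M E i * (leftSlope A E i - raySlope A j) := by positivity
  have h5 : R l * (leftDist M E i * (leftSlope A E i - raySlope A l)) ≤ R l * 1 := by gcongr
  have h6 : R l * (2 * 4) ≤ R l * (R j * (raySlope A l - raySlope A j)) := by
    gcongr; linarith
  nlinarith

theorem area_zero_pos (h : IsZigzag M A E R x y b) {i j : ℕ}
    (hij : j = i ∨ j + 1 = i) (hi : i ≤ M) (hj1 : 1 ≤ j) :
    0 < signedArea x y (2 * i) (2 * j + 1) (2 * 0) := by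
  rw [h.area_left hi (by omega) (Nat.zero_le _), leftDist_zero, leftSlope_zero,
    leftSlope_of_pos A E (show 1 ≤ i by omega)]
  have hr := leftDist_pos M h.E_pos i
  have hRj := h.R_pos (show j ≤ M by omega)
  have hE := h.E_pos
  have h1 := raySlope_mono A (show j ≤ i by omega)
  have h2 := raySlope_add_four_le A hj1
  rw [raySlope_zero] at h2
  have h3 := h.one_div_E_le
  have t1 : 0 < R j * leftDist M E i * (raySlope A i + 1 - raySlope A j) :=
    mul_pos (mul_pos hRj hr) (by linarith)
  have t2 : 0 < R j * E * (raySlope A j - (A + 4 + 1 / E)) :=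
    mul_pos (mul_pos hRj hE) (by linarith)
  have t3 : 0 < E * leftDist M E i * (raySlope A i + 1 - (A + 4 + 1 / E)) :=
    mul_pos (mul_pos hE hr) (by linarith)
  linarith

end IsZigzag

theorem leftSlope_lt_leftSlope (A : ℝ) {E : ℝ} (hE : 2 ≤ E) {i j : ℕ} (h : i < j) :
    leftSlope A E i < leftSlope A E j := by
  rw [leftSlope_of_pos A E (show 1 ≤ j by omega)]
  have h1 := raySlope_add_four_le A h
  rcases Nat.eq_zero_or_pos i with rfl | hi
  · rw [raySlope_zero] at h1
    rw [leftSlope_zero]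
    have h2 : 1 / E ≤ 1 / 2 := one_div_le_one_div_of_le (by norm_num) hE
    linarith
  · rw [leftSlope_of_pos A E hi]
    linarith

namespace IsZigzag

variable {M : ℕ} {A E : ℝ} {R x y b : ℕ → ℝ}

theorem edge_succ (h : IsZigzag M A E R x y b) {k : ℕ} (hk : k ≤ 2 * M) :
    x k * x (k + 1) ≤ 0 ∧
      (b k + b (k + 1)) * (|x k| + |x (k + 1)|) < (y k - y (k + 1)) ^ 2 := by
  obtain ⟨p, rfl | rfl⟩ := Nat.even_or_odd' k
  · exact h.edge_zigzag (by omega) (Or.inl rfl)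
  · have := h.edge_zigzag (i := p + 1) (j := p) (by omega) (Or.inr rfl)
    rwa [mul_comm (x _), add_comm (b _), add_comm |x _|, ← neg_sub (y _), neg_sq] at this

theorem pos_or_nonedge (h : IsZigzag M A E R x y b) {i j : ℕ} (hij : i + 1 < j)
    (hj : j ≤ 2 * M + 1) (hR : ∀ l, i = 0 → j = 2 * l + 1 → R l = E) :
    0 < x i * x j ∨
      (x i * x j ≤ 0 ∧ (y i - y j) ^ 2 < (b i + b j) * (|x i| + |x j|)) := by
  obtain ⟨p, rfl | rfl⟩ := Nat.even_or_odd' i <;> obtain ⟨l, rfl | rfl⟩ := Nat.even_or_odd' j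
  · left
    rw [h.x_left p (by omega), h.x_left l (by omega), neg_mul_neg]
    exact mul_pos (leftDist_pos M h.E_pos p) (leftDist_pos M h.E_pos l)
  · right
    rcases Nat.eq_zero_or_pos p with rfl | hp
    · exact h.nonedge_zero (by omega) (by omega) (hR l rfl rfl)
    · exact h.nonedge_zigzag (by omega) (by omega) hp (by omega) (by omega)
  · right
    have := h.nonedge_zigzag (i := l) (j := p) (by omega) (by omega) (by omega) (by omega)
      (by omega)
    rwa [mul_comm (x _), add_comm (b _), add_comm |x _|, ← neg_sub (y _), neg_sq] at this
  · left
    rw [h.x_right p (by omega), h.x_right l (by omega)]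
    exact mul_pos (h.R_pos (by omega)) (h.R_pos (by omega))

theorem not_collinear (h : IsZigzag M A E R x y b) {i j : ℕ} (hij : i < j) (hj : j ≤ 2 * M + 1)
    (hx : 0 < x i * x j) : x i * y j ≠ x j * y i := by
  have hE := h.E_pos
  obtain ⟨p, rfl | rfl⟩ := Nat.even_or_odd' i <;> obtain ⟨l, rfl | rfl⟩ := Nat.even_or_odd' j
  · rw [h.x_left p (by omega), h.x_left l (by omega), h.y_left p (by omega),
      h.y_left l (by omega)]
    have := mul_lt_mul_of_pos_left (leftSlope_lt_leftSlope A h.two_le_E (show p < l by omega))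
      (mul_pos (leftDist_pos M hE p) (leftDist_pos M hE l))
    apply ne_of_gt
    linarith
  · rw [h.x_left p (by omega), h.x_right l (by omega)] at hx
    nlinarith [mul_pos (leftDist_pos M hE p) (h.R_pos (show l ≤ M by omega))]
  · rw [h.x_left l (by omega), h.x_right p (by omega)] at hx
    nlinarith [mul_pos (leftDist_pos M hE l) (h.R_pos (show p ≤ M by omega))]
  · rw [h.x_right p (by omega), h.x_right l (by omega), h.y_right p (by omega),
      h.y_right l (by omega)]
    have := mul_pos (h.R_pos (show p ≤ M by omega)) (h.R_pos (show l ≤ M by omega))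
    have := mul_le_mul_of_nonneg_left (raySlope_add_four_le A (show p < l by omega)) this.le
    apply ne_of_gt
    linarith

theorem area_succ_pos (h : IsZigzag M A E R x y b) {i k : ℕ} (hik : i + 1 < k)
    (hk : k ≤ 2 * M + 1) : 0 < (-1) ^ i * signedArea x y i (i + 1) k := by
  obtain ⟨p, rfl | rfl⟩ := Nat.even_or_odd' i <;> obtain ⟨l, rfl | rfl⟩ := Nat.even_or_odd' k
  · simpa using h.area_left_pos (Or.inl rfl) (show p < l by omega) (by omega)
  · simpa using h.area_right_pos (i := p) (Or.inl rfl) (by omega) (show p < l by omega) (by omega)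
  · rw [← signedArea_swap_neg_one_pow]
    exact h.area_left_pos (i := p + 1) (Or.inr rfl) (show p + 1 < l by omega) (by omega)
  · rw [← signedArea_swap_neg_one_pow]
    exact h.area_right_pos (i := p + 1) (Or.inr rfl) (by omega) (show p < l by omega) (by omega)

theorem area_succ_zero_pos (h : IsZigzag M A E R x y b) {i : ℕ} (hi : 2 ≤ i)
    (hi' : i ≤ 2 * M) : 0 < (-1) ^ i * signedArea x y i (i + 1) 0 := by
  obtain ⟨p, rfl | rfl⟩ := Nat.even_or_odd' i
  · simpa using h.area_zero_pos (i := p) (Or.inl rfl) (by omega) (by omega)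
  · rw [← signedArea_swap_neg_one_pow]
    exact h.area_zero_pos (i := p + 1) (Or.inr rfl) (by omega) (by omega)

end IsZigzag

theorem exists_isZigzag (M : ℕ) (A E : ℝ) (R : ℕ → ℝ) (hE : 2 * 2 ^ M ≤ E)
    (hR : ∀ j ≤ M, 2 * 2 ^ M ≤ R j) (hR0 : R 0 = E) (x₀ y₀ b₀ : ℝ) :
    ∃ x y b : ℕ → ℝ, IsZigzag M A E R x y b ∧
      x (2 * M + 2) = x₀ ∧ y (2 * M + 2) = y₀ ∧ b (2 * M + 2) = b₀ := by
  have he : ∀ i ≤ M, 2 * i ≠ 2 * M + 2 := fun i hi => by omega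
  have ho : ∀ i ≤ M, 2 * i + 1 ≠ 2 * M + 2 := fun i hi => by omega
  refine ⟨Function.update (interleave (fun i => -leftDist M E i) R) (2 * M + 2) x₀,
    Function.update (interleave (fun i => -(leftDist M E i * leftSlope A E i))
      fun j => raySlope A j * R j) (2 * M + 2) y₀,
    Function.update (interleave (fun i => leftDist M E i * (leftSlope A E i ^ 2 - leftGap i))
      fun j => raySlope A j ^ 2 * R j) (2 * M + 2) b₀, ?_, ?_, ?_, ?_⟩
  · constructor
    · exact hE
    · exact hR
    · exact hR0
    all_goals
      intro i hi
      first
      | rw [Function.update_of_ne (he i hi), interleave_even]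
      | rw [Function.update_of_ne (ho i hi), interleave_odd]
  all_goals simp

theorem exists_unique_longest_noncrossing_even (M : ℕ) (hM : 1 ≤ M) :
    ∃ S : Finset Pt, S.card = 2 * M + 2 ∧
      ∃ C : List Pt, IsHamCycleOn S C ∧
        (∀ L : List Pt, IsHamCycleOn S L → ecycleLen L ≤ ecycleLen C) ∧
        CycleNoncrossing C ∧
        (∀ L : List Pt, IsHamCycleOn S L →
          (∀ L' : List Pt, IsHamCycleOn S L' → ecycleLen L' ≤ ecycleLen L) →
          ∃ r : ℕ, L = C.rotate r ∨ L = (C.rotate r).reverse) := by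
  set q : ℝ := 2 ^ M with hq
  have hq1 : 1 ≤ q := one_le_pow₀ (by norm_num)
  set E : ℝ := 32 * q ^ 3 with hE
  have hq3 : q ≤ q ^ 3 := le_self_pow₀ hq1 (by norm_num)
  set R : ℕ → ℝ := fun j => if j = M then 2 * q else E with hR
  have hR' : ∀ j, j ≠ M → R j = E := fun j hj => if_neg hj
  have hRM : R M = 2 * q := if_pos rfl
  obtain ⟨x, y, b, h, -⟩ := exists_isZigzag M 0 E R (by linarith)
    (fun j _ => by rw [hR]; dsimp only; split_ifs <;> linarith) (hR' 0 (by omega)) 0 0 0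
  have hlow : 3 ≤ raySlope 0 M - leftSlope 0 E 0 := by
    have := raySlope_add_four_le 0 (show 0 < M by omega)
    rw [raySlope_zero] at this
    rw [leftSlope_zero]
    linarith [h.one_div_E_le]
  have hup : raySlope 0 M - leftSlope 0 E 0 ≤ 4 * q := by
    rw [leftSlope_zero, raySlope]
    linarith [h.one_div_E_pos]
  have hEpos := h.E_pos
  refine exists_unique_longest_noncrossing (by omega) x y b ?_ ?_ ?_ ?_ ?_ ?_ ?_
  · exact fun k hk => h.edge_succ (by omega)
  · have := h.edge (Nat.zero_le M) le_rfl ?_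
    · rwa [mul_comm (x _), add_comm (b _), add_comm |x _|, ← neg_sub (y _), neg_sq] at this
    · rw [hRM, leftGap, if_pos rfl, leftDist_zero]
      have : (raySlope 0 M - leftSlope 0 E 0) ^ 2 ≤ (4 * q) ^ 2 := by gcongr
      nlinarith
  · exact fun i j hij hj => h.not_collinear hij (by omega)
  · intro i j hij hj hne
    exact h.pos_or_nonedge hij (by omega) fun l hi hl => hR' l (by omega)
  · exact fun i k hik hk => h.area_succ_pos hik (by omega)
  · exact fun i hi hi' => h.area_succ_zero_pos hi (by omega)
  · intro _
    have e1 := h.area_right (Nat.zero_le M) le_rfl (Nat.zero_le M)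
    have e2 := h.area_left (Nat.zero_le M) le_rfl hM
    have hs := leftSlope_lt_leftSlope 0 h.two_le_E one_pos
    have hr := leftDist_pos M hEpos 1
    have hr1 : leftDist M E 1 ≤ E := by
      nlinarith [leftDist_mul_le_one M E le_rfl, h.two_le_E]
    rw [leftDist_zero, hRM] at e1 e2
    rw [hR' 0 (by omega)] at e1
    have e3 : E * E * (leftSlope 0 E 0 - raySlope 0 0) = E := by
      rw [leftSlope_zero, raySlope_zero]
      field_simp
      ring
    have hqE : 0 < 2 * q * E := by positivity
    constructor
    · rw [signedArea_swap]
      have e1' : signedArea x y 0 (2 * M + 2 - 1) 1 = _ := e1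
      rw [e1']
      have ha := raySlope_mono 0 (Nat.zero_le M)
      nlinarith [mul_le_mul_of_nonneg_left hlow hqE.le]
    · rw [signedArea_swap]
      have e2' : signedArea x y 0 (2 * M + 2 - 1) 2 = _ := e2
      rw [e2']
      have h1 : leftDist M E 1 * (raySlope 0 M - leftSlope 0 E 1) <
          E * (raySlope 0 M - leftSlope 0 E 0) := by
        calc _ < leftDist M E 1 * (raySlope 0 M - leftSlope 0 E 0) := by gcongr
          _ ≤ _ := by gcongr
      have h2 : 0 < leftDist M E 1 * E * (leftSlope 0 E 1 - leftSlope 0 E 0) :=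
        mul_pos (mul_pos hr hEpos) (sub_pos.2 hs)
      nlinarith [mul_lt_mul_of_pos_left h1 (show 0 < 2 * q by linarith)]

theorem IsZigzag.area_apex_pos {M : ℕ} {A E : ℝ} {R x y b : ℕ → ℝ} {z : ℝ}
    (h : IsZigzag M A E R x y b) {i j : ℕ} (hij : j = i ∨ j + 1 = i) (hi : i ≤ M)
    (hxw : x (2 * M + 2) = 0) (hyw : y (2 * M + 2) = -z) (hz1 : z * 32 ≤ 1)
    (hz : 1 ≤ i → z * 32 ≤ leftDist M E i) :
    0 < signedArea x y (2 * i) (2 * j + 1) (2 * M + 2) := by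
  have hR := h.two_le_R (show j ≤ M by omega)
  have e : signedArea x y (2 * i) (2 * j + 1) (2 * M + 2) =
      R j * leftDist M E i * (leftSlope A E i - raySlope A j) - z * (R j + leftDist M E i) := by
    rw [signedArea, h.x_left i hi, h.y_left i hi, h.x_right j (by omega),
      h.y_right j (by omega), hxw, hyw]
    ring
  rw [e]
  rcases Nat.eq_zero_or_pos i with rfl | hi'
  · obtain rfl : j = 0 := by omega
    have hE := h.E_pos
    have e3 : E * E * (leftSlope A E 0 - raySlope A 0) = E := by
      rw [leftSlope_zero, raySlope_zero]
      field_simp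
      ring
    rw [h.R_zero, leftDist_zero, e3]
    nlinarith
  · have hr := leftDist_pos M h.E_pos i
    have h1 : 1 ≤ leftSlope A E i - raySlope A j := by
      rw [leftSlope_of_pos A E hi']
      linarith [raySlope_mono A (show j ≤ i by omega)]
    have h2 := mul_le_mul_of_nonneg_left h1 (mul_pos (by linarith : 0 < R j) hr).le
    have h3 := mul_le_mul_of_nonneg_left (hz hi') (by linarith : 0 ≤ R j)
    nlinarith

theorem exists_unique_longest_noncrossing_odd (M : ℕ) :
    ∃ S : Finset Pt, S.card = 2 * M + 3 ∧
      ∃ C : List Pt, IsHamCycleOn S C ∧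
        (∀ L : List Pt, IsHamCycleOn S L → ecycleLen L ≤ ecycleLen C) ∧
        CycleNoncrossing C ∧
        (∀ L : List Pt, IsHamCycleOn S L →
          (∀ L' : List Pt, IsHamCycleOn S L' → ecycleLen L' ≤ ecycleLen L) →
          ∃ r : ℕ, L = C.rotate r ∨ L = (C.rotate r).reverse) := by
  set q : ℝ := 2 ^ M with hq
  have hq1 : 1 ≤ q := one_le_pow₀ (by norm_num)
  obtain ⟨z, hz⟩ : ∃ z : ℝ, z = ((32 * 2 ^ M) ^ (M + 1))⁻¹ := ⟨_, rfl⟩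
  have hzdist : ∀ E, z = leftDist M E (M + 1) := fun E => by
    rw [hz, leftDist, if_neg (by omega)]
  have hz0 : 0 < z := by rw [hz]; positivity
  have hzq : z * (32 * q) ≤ 1 := by
    rw [hzdist 1]; exact leftDist_mul_le_one M 1 (by omega)
  have hz1 : z * 32 ≤ 1 := by nlinarith
  obtain ⟨A, hA⟩ : ∃ A : ℝ, A = 9 * q ^ 2 / z := ⟨_, rfl⟩
  have hA0 : 0 < A := by rw [hA]; positivity
  have hzA : z * A = 9 * q ^ 2 := by rw [hA]; field_simp
  obtain ⟨E, hE⟩ : ∃ E : ℝ, E = 4 * A + 6 * q + 10 := ⟨_, rfl⟩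
  obtain ⟨x, y, b, h, hxw, hyw, hbw⟩ := exists_isZigzag M A E (fun _ => E) (by linarith)
    (fun _ _ => by linarith) rfl 0 (-z) (2 * z * (A + 3 * q))
  have hE0 := h.E_pos
  have hs0 : leftSlope A E 0 ≤ A + 5 := by
    rw [leftSlope_zero]; linarith [h.one_div_E_le]
  have hzr : ∀ i, 1 ≤ i → i ≤ M → z * 32 ≤ leftDist M E i := by
    intro i hi hiM
    have := leftDist_mul_le M E hi (show i < M + 1 by omega)
    rw [← hzdist E] at this
    nlinarith
  have hnear : ∀ i, 1 ≤ i → A ≤ leftSlope A E i := by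
    intro i hi
    rw [leftSlope_of_pos A E hi, raySlope]
    have : (0 : ℝ) < 2 ^ i := by positivity
    linarith
  refine exists_unique_longest_noncrossing (by omega) x y b ?_ ?_ ?_ ?_ ?_ ?_ ?_
  · intro k hk
    by_cases hk' : k ≤ 2 * M
    · exact h.edge_succ hk'
    obtain rfl : k = 2 * M + 1 := by omega
    rw [hxw, hyw, hbw, h.x_right M le_rfl, h.y_right M le_rfl, h.b_right M le_rfl, abs_zero,
      abs_of_pos hE0]
    refine ⟨by simp, ?_⟩
    have ha : raySlope A M = A + 4 * q := rfl
    nlinarith [mul_pos (mul_pos hz0 hE0) (zero_lt_one.trans_le hq1)]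
  · have e : 2 * M + 3 - 1 = 2 * M + 2 := rfl
    have hx0 := h.x_left 0 (Nat.zero_le M)
    have hy0 := h.y_left 0 (Nat.zero_le M)
    have hb0 := h.b_left 0 (Nat.zero_le M)
    rw [mul_zero, leftDist_zero] at hx0 hy0 hb0
    rw [leftGap, if_pos rfl] at hb0
    rw [e, hxw, hyw, hbw, hx0, hy0, hb0, abs_zero, abs_neg, abs_of_pos hE0]
    refine ⟨by simp, ?_⟩
    have h1 : z * (2 * leftSlope A E 0 + 2 * (A + 3 * q)) < E := by nlinarith
    nlinarith [mul_lt_mul_of_pos_left h1 hE0]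
  · intro i j hij hj hx
    by_cases hj' : j ≤ 2 * M + 1
    · exact h.not_collinear hij hj' hx
    · obtain rfl : j = 2 * M + 2 := by omega
      rw [hxw] at hx
      simp at hx
  · intro i j hij hj hne
    by_cases hj' : j ≤ 2 * M + 1
    · exact h.pos_or_nonedge hij hj' fun l _ _ => rfl
    obtain rfl : j = 2 * M + 2 := by omega
    right
    rw [hxw, hyw, hbw, abs_zero]
    refine ⟨by simp, ?_⟩
    obtain ⟨p, rfl | rfl⟩ := Nat.even_or_odd' i
    · have hp1 : 1 ≤ p := by omega
      have hp : p ≤ M := by omega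
      have hr := leftDist_pos M hE0 p
      have hr1 : leftDist M E p ≤ 1 := by nlinarith [leftDist_mul_le_one M E hp1]
      rw [h.x_left p hp, h.y_left p hp, h.b_left p hp, abs_neg, abs_of_pos hr]
      have hd : leftGap p ≤ z * A := by
        have : (2 : ℝ) ^ p ≤ q := pow_le_pow_right₀ (by norm_num) hp
        have e4 : (4 : ℝ) ^ p = (2 ^ p) ^ 2 := by rw [← pow_mul, mul_comm, pow_mul]; norm_num
        rw [hzA, leftGap, if_neg (by omega), e4]
        gcongr
      have h1 : leftDist M E p * leftGap p ≤ 1 * (z * A) := by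
        have : 0 < z * A := mul_pos hz0 hA0
        nlinarith
      have h2 := mul_le_mul_of_nonneg_left h1 hr.le
      have h3 := mul_le_mul_of_nonneg_left (hnear p hp1) (mul_pos hr hz0).le
      have h4 : z < leftDist M E p * q * 6 := by nlinarith [hzr p hp1 hp]
      have h5 := mul_pos (mul_pos hr hz0) hA0
      nlinarith [mul_lt_mul_of_pos_left h4 hz0]
    · have hp : p < M := by omega
      rw [h.x_right p hp.le, h.y_right p hp.le, h.b_right p hp.le, abs_of_pos hE0]
      have ha : raySlope A p ≤ A + 2 * q := by
        have : (2 : ℝ) ^ (p + 1) ≤ q := pow_le_pow_right₀ (by norm_num) hp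
        rw [pow_succ] at this
        rw [raySlope]
        linarith
      have h1 := mul_le_mul_of_nonneg_left ha (mul_pos hz0 hE0).le
      have h2 : z < 2 * E * q := by nlinarith
      nlinarith [mul_lt_mul_of_pos_left h2 hz0]
  · intro i k hik hk
    by_cases hk' : k ≤ 2 * M + 1
    · exact h.area_succ_pos hik hk'
    obtain rfl : k = 2 * M + 2 := by omega
    obtain ⟨p, rfl | rfl⟩ := Nat.even_or_odd' i
    · simpa using h.area_apex_pos (i := p) (Or.inl rfl) (by omega) hxw hyw hz1
        fun hp => hzr p hp (by omega)
    · rw [← signedArea_swap_neg_one_pow]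
      exact h.area_apex_pos (i := p + 1) (Or.inr rfl) (by omega) hxw hyw hz1
        fun hp => hzr _ hp (by omega)
  · intro i hi hi'
    by_cases hi'' : i ≤ 2 * M
    · exact h.area_succ_zero_pos hi hi''
    obtain rfl : i = 2 * M + 1 := by omega
    have hx0 := h.x_left 0 (Nat.zero_le M)
    have hy0 := h.y_left 0 (Nat.zero_le M)
    rw [mul_zero, leftDist_zero] at hx0 hy0
    rw [← signedArea_swap_neg_one_pow, signedArea, hxw, hyw, hx0, hy0, h.x_right M le_rfl,
      h.y_right M le_rfl]
    have h1 := raySlope_add_four_le A (show 0 < M by omega)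
    rw [raySlope_zero] at h1
    have h2 : leftSlope A E 0 < raySlope A M := by
      rw [leftSlope_zero]; linarith [h.one_div_E_le]
    nlinarith [mul_lt_mul_of_pos_left h2 (mul_pos hE0 hE0), mul_pos hz0 hE0]
  · intro hn
    have e : 2 * M + 3 - 1 = 2 * M + 2 := rfl
    rw [e]
    constructor
    · rw [← signedArea_rotate]
      exact h.area_apex_pos (i := 0) (j := 0) (Or.inl rfl) (Nat.zero_le M) hxw hyw hz1 (by omega)
    · have hx0 := h.x_left 0 (Nat.zero_le M)
      have hy0 := h.y_left 0 (Nat.zero_le M)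
      have hx2 := h.x_left 1 (by omega)
      have hy2 := h.y_left 1 (by omega)
      rw [mul_zero, leftDist_zero] at hx0 hy0
      rw [mul_one] at hx2 hy2
      rw [signedArea, hxw, hyw, hx0, hy0, hx2, hy2]
      have hr := leftDist_pos M hE0 1
      have h1 : 1 ≤ leftSlope A E 1 - leftSlope A E 0 := by
        rw [leftSlope_of_pos A E le_rfl, leftSlope_zero]
        have := raySlope_add_four_le A one_pos
        rw [raySlope_zero] at this
        linarith [h.one_div_E_le]
      have h2 : z < leftDist M E 1 := by linarith [hzr 1 le_rfl (by omega)]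
      nlinarith [mul_le_mul_of_nonneg_left h1 (mul_pos hE0 hr).le,
        mul_lt_mul_of_pos_left h2 hE0, mul_pos hz0 hr]

/-- For every `n ≥ 3` there is a set of `n` points in the plane whose longest
Hamiltonian cycle is unique (up to rotation and reflection) and noncrossing. -/
theorem stmt8 (n : ℕ) (hn : 3 ≤ n) :
    ∃ S : Finset Pt, S.card = n ∧
      ∃ C : List Pt, IsHamCycleOn S C ∧
        (∀ L : List Pt, IsHamCycleOn S L → ecycleLen L ≤ ecycleLen C) ∧
        CycleNoncrossing C ∧
        (∀ L : List Pt, IsHamCycleOn S L →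
          (∀ L' : List Pt, IsHamCycleOn S L' → ecycleLen L' ≤ ecycleLen L) →
          ∃ r : ℕ, L = C.rotate r ∨ L = (C.rotate r).reverse) := by
  obtain ⟨M, rfl | rfl⟩ : ∃ M, n = 2 * M + 2 ∨ n = 2 * M + 3 :=
    ⟨(n - 2) / 2, by omega⟩
  · exact exists_unique_longest_noncrossing_even M (by omega)
  · exact exists_unique_longest_noncrossing_odd M
end
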